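/- arXiv:1006.2523 — 4 statements merged into one kernel-verified Lean document; each statement's English description precedes it below -/
import Mathlib

section
/- Let 𝒳 be a finite set, μ : 𝒳 → (0,1] a probability measure, and C : 𝒳×𝒳 → [0,∞) symmetric. For a probability measure ω on 𝒳 and a finite symmetric measure ϖ on 𝒳×𝒳, define Î₂(ω,ϖ) = sup over functions f : 𝒳 → ℝ and symmetric functions g : 𝒳×𝒳 → ℝ of [ Σ_{a∈𝒳} (f(a) − U_f)·ω(a) + (1/2)·Σ_{a,b∈𝒳} g(a,b)·(ϖ(a,b) − C(a,b)·ω(a)·ω(b)) ], where U_f = log Σ_{a∈𝒳} e^{f(a)}·μ(a). Then Î₂(ω,ϖ) = H(ω‖μ) if ϖ(a,b) = C(a,b)·ω(a)·ω(b) for all a,b ∈ 𝒳, and Î₂(ω,ϖ) = +∞ otherwise. -/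
open Filter
open scoped ENNReal

noncomputable section

namespace CRG

variable {𝒳 : Type} [Fintype 𝒳] [DecidableEq 𝒳]

/-- The set `ℰ` of formally ordered potential edges on `{1,…,n}`. -/
abbrev Edges (n : ℕ) : Finset (Fin n × Fin n) :=
  Finset.univ.filter (fun e : Fin n × Fin n => e.1 < e.2)

/-- The probability weight `P_n(x)` of a coloured graph `x` (colouring, edge set) under the
coloured random graph law with colour law `μ` and connection probabilities `p`. -/
def graphWeight (μ : 𝒳 → ℝ) (p : 𝒳 → 𝒳 → ℝ) (n : ℕ)
    (x : (Fin n → 𝒳) × Finset (Fin n × Fin n)) : ℝ :=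
  (if x.2 ⊆ Edges n then 1 else 0) *
  (∏ v, μ (x.1 v)) *
  ∏ e ∈ Edges n, (if e ∈ x.2 then p (x.1 e.1) (x.1 e.2) else 1 - p (x.1 e.1) (x.1 e.2))

/-- The probability `ℙ_n(S)` of an event `S` under the coloured random graph law. -/
def graphPr (μ : 𝒳 → ℝ) (p : 𝒳 → 𝒳 → ℝ) (n : ℕ)
    (S : Set ((Fin n → 𝒳) × Finset (Fin n × Fin n))) : ℝ :=
  ∑ x, S.indicator (graphWeight μ p n) x

/-- The empirical colour measure `L¹`. -/
def L1 (n : ℕ) (x : (Fin n → 𝒳) × Finset (Fin n × Fin n)) (a : 𝒳) : ℝ :=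
  ((Finset.univ.filter (fun v : Fin n => x.1 v = a)).card : ℝ) / n

/-- The empirical pair measure `L²` (scaled by `1/(n² aₙ)`). -/
def L2 (an : ℝ) (n : ℕ) (x : (Fin n → 𝒳) × Finset (Fin n × Fin n)) (q : 𝒳 × 𝒳) : ℝ :=
  (∑ e ∈ x.2, ((if (x.1 e.1, x.1 e.2) = q then (1:ℝ) else 0)
    + (if (x.1 e.2, x.1 e.1) = q then (1:ℝ) else 0))) / ((n:ℝ)^2 * an)

/-- Extended-real logarithm, `log 0 = -∞`. -/
def elog (x : ℝ) : EReal := if x ≤ 0 then ⊥ else ((Real.log x : ℝ) : EReal)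

/-- `ℳ(𝒳) × ℳ̃_*(𝒳×𝒳)`: probability vectors paired with finite symmetric measures,
viewed inside `ℝ^𝒳 × ℝ^(𝒳×𝒳)`. -/
def MSpace (𝒳 : Type) [Fintype 𝒳] : Set ((𝒳 → ℝ) × (𝒳 × 𝒳 → ℝ)) :=
  {z | (∀ a, 0 ≤ z.1 a) ∧ (∑ a, z.1 a) = 1 ∧ (∀ q, 0 ≤ z.2 q) ∧ ∀ a b, z.2 (a,b) = z.2 (b,a)}

open Classical in
/-- Relative entropy `H(ν‖ρ)` of measures on a finite set, `+∞` if `ν` is not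
absolutely continuous w.r.t. `ρ`. -/
def relEnt (ν ρ : 𝒳 → ℝ) : ℝ≥0∞ :=
  if ∀ x, ρ x = 0 → ν x = 0 then
    ENNReal.ofReal (∑ x, ν x * Real.log (ν x / ρ x)) else ⊤

open Classical in
/-- `𝔥_C(ϖ‖ω) = H(ϖ‖Cω⊗ω) + ‖Cω⊗ω‖ − ‖ϖ‖`. -/
def hRel (C : 𝒳 → 𝒳 → ℝ) (ω : 𝒳 → ℝ) (ϖ : 𝒳 × 𝒳 → ℝ) : ℝ≥0∞ :=
  if ∀ q : 𝒳 × 𝒳, C q.1 q.2 * ω q.1 * ω q.2 = 0 → ϖ q = 0 then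
    ENNReal.ofReal ((∑ q : 𝒳 × 𝒳, ϖ q * Real.log (ϖ q / (C q.1 q.2 * ω q.1 * ω q.2)))
      + (∑ q : 𝒳 × 𝒳, C q.1 q.2 * ω q.1 * ω q.2) - ∑ q : 𝒳 × 𝒳, ϖ q)
  else ⊤

end CRG

open CRG

/-- The variational functional `Î₂(ω,ϖ)` of Lemma 3.5, a supremum over functions
`f : 𝒳 → ℝ` and symmetric `g : 𝒳×𝒳 → ℝ`, with `U_f = log Σ_a e^(f a) μ(a)`. -/
def Ihat2 {𝒳 : Type} [Fintype 𝒳] (μ : 𝒳 → ℝ) (C : 𝒳 → 𝒳 → ℝ)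
    (ω : 𝒳 → ℝ) (ϖ : 𝒳 × 𝒳 → ℝ) : EReal :=
  ⨆ (f : 𝒳 → ℝ), ⨆ (g : 𝒳 × 𝒳 → ℝ), ⨆ (_ : ∀ i j, g (i,j) = g (j,i)),
    (((∑ i, (f i - Real.log (∑ j, Real.exp (f j) * μ j)) * ω i)
      + (1/2) * ∑ q : 𝒳 × 𝒳, g q * (ϖ q - C q.1 q.2 * ω q.1 * ω q.2) : ℝ) : EReal)

/-- The pointwise Gibbs inequality `w (x - log Z) ≤ w log (w / m) + (exp x m / Z - w)`. -/
lemma gibbs_pointwise {x Z w m : ℝ} (hZ : 0 < Z) (hw : 0 ≤ w) (hm : 0 < m) :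
    (x - Real.log Z) * w ≤ w * Real.log (w / m) + (Real.exp x * m / Z - w) := by
  rcases hw.eq_or_lt with rfl | hw
  · simp only [mul_zero, zero_mul, zero_add, sub_zero]
    positivity
  · have hlog : Real.log (Real.exp x * m / (Z * w))
        = x - Real.log Z - Real.log (w / m) := by
      rw [Real.log_div (by positivity) (by positivity),
        Real.log_mul (Real.exp_ne_zero x) hm.ne', Real.log_mul hZ.ne' hw.ne',
        Real.log_div hw.ne' hm.ne', Real.log_exp]
      ring
    have hle : Real.log (Real.exp x * m / (Z * w)) ≤ Real.exp x * m / (Z * w) - 1 :=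
      Real.log_le_sub_one_of_pos (by positivity)
    rw [hlog] at hle
    have hmul := mul_le_mul_of_nonneg_left hle hw.le
    have hcancel : w * (Real.exp x * m / (Z * w) - 1) = Real.exp x * m / Z - w := by
      field_simp
    linarith

/-- The upper bound in the Donsker–Varadhan formula on a finite set. -/
lemma sum_sub_log_mul_le {𝒳 : Type} [Fintype 𝒳] [Nonempty 𝒳] {μ ω : 𝒳 → ℝ}
    (hμ0 : ∀ a, 0 < μ a) (hω0 : ∀ a, 0 ≤ ω a) (hωs : ∑ a, ω a = 1) (f : 𝒳 → ℝ) :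
    ∑ i, (f i - Real.log (∑ j, Real.exp (f j) * μ j)) * ω i
      ≤ ∑ i, ω i * Real.log (ω i / μ i) := by
  have hZ : 0 < ∑ j, Real.exp (f j) * μ j :=
    Finset.sum_pos (fun j _ => mul_pos (Real.exp_pos _) (hμ0 j)) Finset.univ_nonempty
  calc ∑ i, (f i - Real.log (∑ j, Real.exp (f j) * μ j)) * ω i
      ≤ ∑ i, (ω i * Real.log (ω i / μ i)
          + (Real.exp (f i) * μ i / (∑ j, Real.exp (f j) * μ j) - ω i)) :=
        Finset.sum_le_sum fun i _ => gibbs_pointwise hZ (hω0 i) (hμ0 i)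
    _ = ∑ i, ω i * Real.log (ω i / μ i) := by
        rw [Finset.sum_add_distrib, Finset.sum_sub_distrib, ← Finset.sum_div,
          div_self hZ.ne', hωs, sub_self, add_zero]

/-- The test function `log (ω / μ + ε)` attains the relative entropy up to `ε`. -/
lemma sum_mul_log_sub_le {𝒳 : Type} [Fintype 𝒳] {μ ω : 𝒳 → ℝ}
    (hμ0 : ∀ a, 0 < μ a) (hμs : ∑ a, μ a = 1) (hω0 : ∀ a, 0 ≤ ω a) (hωs : ∑ a, ω a = 1)
    {ε : ℝ} (hε : 0 < ε) :
    (∑ i, ω i * Real.log (ω i / μ i)) - ε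
      ≤ ∑ i, (Real.log (ω i / μ i + ε)
          - Real.log (∑ j, Real.exp (Real.log (ω j / μ j + ε)) * μ j)) * ω i := by
  have hpos : ∀ i, 0 < ω i / μ i + ε := fun i =>
    add_pos_of_nonneg_of_pos (div_nonneg (hω0 i) (hμ0 i).le) hε
  have hZ : ∑ j, Real.exp (Real.log (ω j / μ j + ε)) * μ j = 1 + ε := by
    have hterm : ∀ j, Real.exp (Real.log (ω j / μ j + ε)) * μ j = ω j + ε * μ j := fun j => by
      rw [Real.exp_log (hpos j), add_mul, div_mul_cancel₀ _ (hμ0 j).ne']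
    simp only [hterm]
    rw [Finset.sum_add_distrib, ← Finset.mul_sum, hωs, hμs, mul_one]
  have hlog : Real.log (1 + ε) ≤ ε := by
    linarith [Real.log_le_sub_one_of_pos (show 0 < 1 + ε by positivity)]
  rw [hZ]
  calc (∑ i, ω i * Real.log (ω i / μ i)) - ε
      = ∑ i, (ω i * Real.log (ω i / μ i) - ε * ω i) := by
        rw [Finset.sum_sub_distrib, ← Finset.mul_sum, hωs, mul_one]
    _ ≤ _ := Finset.sum_le_sum fun i _ => by
        rcases (hω0 i).eq_or_lt with h | h
        · simp [← h]
        · have hmono : Real.log (ω i / μ i) ≤ Real.log (ω i / μ i + ε) :=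
            Real.log_le_log (div_pos h (hμ0 i)) (by linarith)
          nlinarith

open Classical in
/-- **Solution of the variational problem for `Î₂`** (Lemma 3.6):
`Î₂(ω,ϖ) = H(ω‖μ)` if `ϖ = Cω⊗ω`, and `Î₂(ω,ϖ) = +∞` otherwise. -/
theorem variational_Ihat2
    {𝒳 : Type} [Fintype 𝒳] [DecidableEq 𝒳] [Nonempty 𝒳]
    (μ : 𝒳 → ℝ) (hμ0 : ∀ a, 0 < μ a) (hμ1 : ∀ a, μ a ≤ 1) (hμs : ∑ a, μ a = 1)
    (C : 𝒳 → 𝒳 → ℝ) (hC0 : ∀ a b, 0 ≤ C a b) (hCsymm : ∀ a b, C a b = C b a)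
    (ω : 𝒳 → ℝ) (hω0 : ∀ a, 0 ≤ ω a) (hωs : ∑ a, ω a = 1)
    (ϖ : 𝒳 × 𝒳 → ℝ) (hϖ0 : ∀ q, 0 ≤ ϖ q) (hϖsymm : ∀ i j, ϖ (i,j) = ϖ (j,i)) :
    Ihat2 μ C ω ϖ =
      if ϖ = (fun q : 𝒳 × 𝒳 => C q.1 q.2 * ω q.1 * ω q.2) then
        ((∑ i, ω i * Real.log (ω i / μ i) : ℝ) : EReal)
      else ⊤ := by
  have hle : ∀ (f : 𝒳 → ℝ) (g : 𝒳 × 𝒳 → ℝ), (∀ i j, g (i,j) = g (j,i)) →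
      (((∑ i, (f i - Real.log (∑ j, Real.exp (f j) * μ j)) * ω i)
        + (1/2) * ∑ q : 𝒳 × 𝒳, g q * (ϖ q - C q.1 q.2 * ω q.1 * ω q.2) : ℝ) : EReal)
      ≤ Ihat2 μ C ω ϖ := fun f g hg =>
    le_iSup_of_le f (le_iSup_of_le g (le_iSup_of_le hg le_rfl))
  split_ifs with h
  · have hzero : ∀ q : 𝒳 × 𝒳, ϖ q - C q.1 q.2 * ω q.1 * ω q.2 = 0 := fun q =>
      sub_eq_zero.2 (congrFun h q)
    refine le_antisymm ?_ ?_
    · refine iSup_le fun f => iSup_le fun g => iSup_le fun _ => EReal.coe_le_coe_iff.2 ?_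
      simpa only [hzero, mul_zero, Finset.sum_const_zero, add_zero]
        using sum_sub_log_mul_le hμ0 hω0 hωs f
    · refine EReal.ge_of_forall_gt_iff_ge.1 fun y hy => ?_
      have hε := sub_pos.2 (EReal.coe_lt_coe_iff.1 hy)
      refine le_trans (EReal.coe_le_coe_iff.2 ?_)
        (hle (fun i => Real.log (ω i / μ i + ((∑ i, ω i * Real.log (ω i / μ i)) - y))) 0
          fun _ _ => rfl)
      have hlower := sum_mul_log_sub_le hμ0 hμs hω0 hωs hε
      rw [sub_sub_cancel] at hlower
      simpa only [Pi.zero_apply, zero_mul, Finset.sum_const_zero, mul_zero, add_zero]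
        using hlower
  · set D : 𝒳 × 𝒳 → ℝ := fun q => ϖ q - C q.1 q.2 * ω q.1 * ω q.2 with hD
    have hDsymm : ∀ i j, D (i,j) = D (j,i) := fun i j => by
      simp only [hD]
      rw [hϖsymm i j, hCsymm i j]
      ring
    have hS : 0 < ∑ q, D q * D q := by
      obtain ⟨q, hq⟩ := Function.ne_iff.1 h
      exact Finset.sum_pos' (fun q _ => mul_self_nonneg _)
        ⟨q, Finset.mem_univ q, mul_self_pos.2 (sub_ne_zero.2 hq)⟩
    refine EReal.eq_top_iff_forall_lt _ |>.2 fun y => ?_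
    have key := hle 0 (fun q => 2 * (y + 1) / (∑ q, D q * D q) * D q)
      fun i j => by simp only [hDsymm i j]
    refine lt_of_lt_of_le (EReal.coe_lt_coe_iff.2 ?_) key
    have hsum : ∑ q, 2 * (y + 1) / (∑ q, D q * D q) * D q * D q = 2 * (y + 1) := by
      simp only [mul_assoc _ (D _) (D _)]
      rw [← Finset.mul_sum, div_mul_cancel₀ _ hS.ne']
    change y < _ + 1 / 2 * ∑ q, 2 * (y + 1) / (∑ q, D q * D q) * D q * D q
    rw [hsum]
    simp [hμs]
end
end

section
/- Let X be a coloured random graph with colour law μ : 𝒳 → (0,1] and connection probabilities p_n satisfying a_n^{-1}·p_n(a,b) → C(a,b) for all a,b ∈ 𝒳, for some symmetric C : 𝒳×𝒳 → [0,∞) and a sequence (a_n) with a_n → 0 and n·a_n → ∞. Then for every open set O ⊂ ℳ(𝒳)×ℳ̃_*(𝒳×𝒳), liminf_{n→∞} (1/n)·log ℙ{ (L¹, L²) ∈ O } ≥ −inf_{(ω,ϖ)∈O} I₂(ω,ϖ), where I₂(ω,ϖ) = H(ω‖μ) if ϖ = Cω⊗ω and I₂(ω,ϖ) = +∞ otherwise.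 -/
open Filter
open scoped ENNReal

noncomputable section

open CRG

open Classical in
/-- The rate function `I₂(ω,ϖ) = H(ω‖μ)` if `ϖ = Cω⊗ω`, `+∞` otherwise. -/
def I2 {𝒳 : Type} [Fintype 𝒳] (μ : 𝒳 → ℝ) (C : 𝒳 → 𝒳 → ℝ)
    (z : (𝒳 → ℝ) × (𝒳 × 𝒳 → ℝ)) : ℝ≥0∞ :=
  if z.2 = (fun q : 𝒳 × 𝒳 => C q.1 q.2 * z.1 q.1 * z.1 q.2) then relEnt z.1 μ else ⊤

/-- Total mass, mean and variance of a weighted sum of independent Bernoulli variables. -/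
theorem bernoulli_moments {α : Type*} [DecidableEq α] (p g : α → ℝ) (s : Finset α) :
    (∑ E ∈ s.powerset, ∏ e ∈ s, (if e ∈ E then p e else 1 - p e)) = 1 ∧
    (∑ E ∈ s.powerset, (∏ e ∈ s, (if e ∈ E then p e else 1 - p e)) *
      (∑ e ∈ E, g e - ∑ e ∈ s, p e * g e)) = 0 ∧
    (∑ E ∈ s.powerset, (∏ e ∈ s, (if e ∈ E then p e else 1 - p e)) *
      (∑ e ∈ E, g e - ∑ e ∈ s, p e * g e) ^ 2) = ∑ e ∈ s, p e * (1 - p e) * g e ^ 2 := by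
  induction s using Finset.induction_on with
  | empty => simp
  | insert i s hi ih =>
    have split (F : ℝ → ℝ) :
        (∑ E ∈ (insert i s).powerset, (∏ e ∈ insert i s, (if e ∈ E then p e else 1 - p e)) *
          F (∑ e ∈ E, g e - ∑ e ∈ insert i s, p e * g e)) =
        ∑ E ∈ s.powerset, (∏ e ∈ s, (if e ∈ E then p e else 1 - p e)) *
          ((1 - p i) * F ((∑ e ∈ E, g e - ∑ e ∈ s, p e * g e) - p i * g i) +
            p i * F ((∑ e ∈ E, g e - ∑ e ∈ s, p e * g e) + (1 - p i) * g i)) := by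
      rw [Finset.sum_powerset_insert hi, ← Finset.sum_add_distrib]
      refine Finset.sum_congr rfl fun E hE => ?_
      have hiE : i ∉ E := fun h => hi (Finset.mem_powerset.1 hE h)
      have hprod : ∏ e ∈ s, (if e ∈ insert i E then p e else 1 - p e) =
          ∏ e ∈ s, (if e ∈ E then p e else 1 - p e) := by
        refine Finset.prod_congr rfl fun e he => ?_
        have : e ≠ i := fun h => hi (h ▸ he)
        simp [this]
      rw [Finset.prod_insert hi, Finset.prod_insert hi, Finset.sum_insert hi,
        Finset.sum_insert hiE, hprod, if_neg hiE, if_pos (Finset.mem_insert_self i E)]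
      rw [show ∑ e ∈ E, g e - (p i * g i + ∑ e ∈ s, p e * g e) =
          (∑ e ∈ E, g e - ∑ e ∈ s, p e * g e) - p i * g i by ring,
        show g i + ∑ e ∈ E, g e - (p i * g i + ∑ e ∈ s, p e * g e) =
          (∑ e ∈ E, g e - ∑ e ∈ s, p e * g e) + (1 - p i) * g i by ring]
      ring
    obtain ⟨h0, h1, h2⟩ := ih
    refine ⟨?_, ?_, ?_⟩
    · have := split fun _ => 1
      simpa [h0] using this
    · rw [split fun y => y, ← h1]
      exact Finset.sum_congr rfl fun E _ => by ring
    · have hmass := congrArg (p i * (1 - p i) * g i ^ 2 * ·) h0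
      simp only [mul_one] at hmass
      rw [split fun y => y ^ 2, Finset.sum_insert hi, ← h2, ← hmass, Finset.mul_sum,
        ← Finset.sum_add_distrib]
      exact Finset.sum_congr rfl fun E _ => by ring

/-- Total mass, mean and variance of a sum of centred i.i.d. variables on a finite set. -/
theorem iid_moments {𝒳 : Type*} [Fintype 𝒳] (ω h : 𝒳 → ℝ) (hω : ∑ a, ω a = 1)
    (hh : ∑ a, ω a * h a = 0) (n : ℕ) :
    (∑ σ : Fin n → 𝒳, ∏ v, ω (σ v)) = 1 ∧
    (∑ σ : Fin n → 𝒳, (∏ v, ω (σ v)) * ∑ v, h (σ v)) = 0 ∧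
    (∑ σ : Fin n → 𝒳, (∏ v, ω (σ v)) * (∑ v, h (σ v)) ^ 2) = n * ∑ a, ω a * h a ^ 2 := by
  induction n with
  | zero => simp
  | succ n ih =>
    have split (F : ℝ → ℝ) :
        (∑ σ : Fin (n + 1) → 𝒳, (∏ v, ω (σ v)) * F (∑ v, h (σ v))) =
        ∑ σ : Fin n → 𝒳, (∏ v, ω (σ v)) * ∑ b, ω b * F (h b + ∑ v, h (σ v)) := by
      rw [← (Fin.consEquiv fun _ : Fin (n + 1) => 𝒳).sum_comp, Fintype.sum_prod_type,
        Finset.sum_comm]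
      refine Finset.sum_congr rfl fun σ _ => ?_
      rw [Finset.mul_sum]
      refine Finset.sum_congr rfl fun b _ => ?_
      simp only [Fin.consEquiv_apply, Fin.prod_univ_succ, Fin.sum_univ_succ, Fin.cons_zero,
        Fin.cons_succ]
      ring
    obtain ⟨h0, h1, h2⟩ := ih
    refine ⟨?_, ?_, ?_⟩
    · have := split fun _ => 1
      simpa [h0, hω] using this
    · rw [split fun y => y, ← h1]
      refine Finset.sum_congr rfl fun σ _ => ?_
      simp_rw [mul_add, Finset.sum_add_distrib, ← Finset.sum_mul, hh, hω]
      ring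
    · rw [split fun y => y ^ 2]
      have key (σ : Fin n → 𝒳) : (∏ v, ω (σ v)) * ∑ b, ω b * (h b + ∑ v, h (σ v)) ^ 2 =
          (∏ v, ω (σ v)) * (∑ b, ω b * h b ^ 2) + (∏ v, ω (σ v)) * (∑ v, h (σ v)) ^ 2 := by
        rw [← mul_add]
        congr 1
        have (b : 𝒳) : ω b * (h b + ∑ v, h (σ v)) ^ 2 = ω b * h b ^ 2 +
            ω b * h b * (2 * ∑ v, h (σ v)) + ω b * (∑ v, h (σ v)) ^ 2 := by ring
        simp_rw [this, Finset.sum_add_distrib, ← Finset.sum_mul, hh, hω]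
        ring
      simp_rw [key, Finset.sum_add_distrib, ← Finset.sum_mul, h0, h2]
      push_cast
      ring

/-- Chebyshev's inequality combined with the union bound, for a finite weighted sum. -/
theorem one_sub_le_sum_of_sq_le {ι κ : Type*} [Fintype κ] (s : Finset ι) (w : ι → ℝ)
    (hw : ∀ i ∈ s, 0 ≤ w i) (hw1 : ∑ i ∈ s, w i = 1) (Y : κ → ι → ℝ) (V : κ → ℝ)
    (hV : ∀ k, ∑ i ∈ s, w i * Y k i ^ 2 ≤ V k) {ε : ℝ} (hε : 0 < ε) (S : Set ι)
    (hS : ∀ i ∈ s, (∀ k, |Y k i| < ε) → i ∈ S) :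
    1 - (∑ k, V k) / ε ^ 2 ≤ ∑ i ∈ s, S.indicator w i := by
  have hpt : ∀ i ∈ s, w i * (1 - (∑ k, Y k i ^ 2) / ε ^ 2) ≤ S.indicator w i := by
    intro i hi
    have hsum : 0 ≤ (∑ k, Y k i ^ 2) / ε ^ 2 := by positivity
    by_cases hiS : i ∈ S
    · rw [Set.indicator_of_mem hiS]
      nlinarith [hw i hi]
    · rw [Set.indicator_of_notMem hiS]
      have : ∃ k, ε ≤ |Y k i| := by
        by_contra! hc
        exact hiS (hS i hi hc)
      obtain ⟨k, hk⟩ := this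
      have h1 : ε ^ 2 ≤ Y k i ^ 2 := by
        rw [← sq_abs (Y k i)]
        gcongr
      have h2 : Y k i ^ 2 ≤ ∑ k, Y k i ^ 2 :=
        Finset.single_le_sum (f := fun k => Y k i ^ 2) (fun _ _ => sq_nonneg _)
          (Finset.mem_univ k)
      have h3 : 1 ≤ (∑ k, Y k i ^ 2) / ε ^ 2 := by
        rw [le_div_iff₀ (by positivity)]
        linarith
      exact mul_nonpos_of_nonneg_of_nonpos (hw i hi) (by linarith)
  refine le_trans ?_ (Finset.sum_le_sum hpt)
  have : ∑ i ∈ s, w i * (1 - (∑ k, Y k i ^ 2) / ε ^ 2) =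
      1 - (∑ k, ∑ i ∈ s, w i * Y k i ^ 2) / ε ^ 2 := by
    rw [Finset.sum_comm]
    simp_rw [mul_sub, mul_one, Finset.sum_sub_distrib, hw1, Finset.sum_div, Finset.mul_sum,
      mul_div_assoc]
  rw [this]
  gcongr
  exact hV _

namespace CRG

variable {𝒳 : Type}

/-- The number of (ordered) ways an edge `e` of a graph coloured by `σ` has colour pair `q`. -/
def pairCount [DecidableEq 𝒳] {n : ℕ} (σ : Fin n → 𝒳) (q : 𝒳 × 𝒳) (e : Fin n × Fin n) : ℝ :=
  (if (σ e.1, σ e.2) = q then (1:ℝ) else 0) + (if (σ e.2, σ e.1) = q then (1:ℝ) else 0)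

theorem graphPr_eq_sum [Fintype 𝒳] (μ : 𝒳 → ℝ) (p : 𝒳 → 𝒳 → ℝ) (n : ℕ)
    (S : Set ((Fin n → 𝒳) × Finset (Fin n × Fin n))) :
    graphPr μ p n S = ∑ σ : Fin n → 𝒳, (∏ v, μ (σ v)) * ∑ E ∈ (Edges n).powerset,
      {E | (σ, E) ∈ S}.indicator (fun E => ∏ e ∈ Edges n,
        (if e ∈ E then p (σ e.1) (σ e.2) else 1 - p (σ e.1) (σ e.2))) E := by
  classical
  rw [graphPr, Fintype.sum_prod_type]
  refine Finset.sum_congr rfl fun σ _ => ?_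
  rw [Finset.mul_sum]
  symm
  rw [← Finset.sum_subset (Finset.subset_univ (Edges n).powerset)]
  · refine Finset.sum_congr rfl fun E hE => ?_
    have hE' : E ⊆ Edges n := Finset.mem_powerset.1 hE
    by_cases h : (σ, E) ∈ S
    · rw [Set.indicator_of_mem h, Set.indicator_of_mem (show E ∈ {E | (σ, E) ∈ S} from h),
        graphWeight, if_pos hE', one_mul]
    · rw [Set.indicator_of_notMem h,
        Set.indicator_of_notMem (show E ∉ {E | (σ, E) ∈ S} from h), mul_zero]
  · intro E _ hE
    have hE' : ¬ E ⊆ Edges n := fun h => hE (Finset.mem_powerset.2 h)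
    by_cases h : (σ, E) ∈ S
    · rw [Set.indicator_of_mem h, graphWeight, if_neg hE', zero_mul, zero_mul]
    · rw [Set.indicator_of_notMem h]

theorem L1_eq_sum [DecidableEq 𝒳] (n : ℕ) (x : (Fin n → 𝒳) × Finset (Fin n × Fin n)) (b : 𝒳) :
    L1 n x b = (∑ v, if x.1 v = b then (1:ℝ) else 0) / n := by
  simp [L1]

theorem L1_nonneg [DecidableEq 𝒳] (n : ℕ) (x : (Fin n → 𝒳) × Finset (Fin n × Fin n)) (b : 𝒳) :
    0 ≤ L1 n x b := by
  unfold L1; positivity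

theorem L1_le_one [DecidableEq 𝒳] (n : ℕ) (x : (Fin n → 𝒳) × Finset (Fin n × Fin n)) (b : 𝒳) :
    L1 n x b ≤ 1 := by
  refine div_le_one_of_le₀ ?_ (Nat.cast_nonneg n)
  exact_mod_cast (Finset.card_le_univ _).trans_eq (Fintype.card_fin n)

theorem sum_comp_eq_mul_sum_L1 [Fintype 𝒳] [DecidableEq 𝒳] {n : ℕ} (hn : 0 < n)
    (x : (Fin n → 𝒳) × Finset (Fin n × Fin n)) (f : 𝒳 → ℝ) :
    ∑ v, f (x.1 v) = n * ∑ b, L1 n x b * f b := by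
  have hn' : (n : ℝ) ≠ 0 := by positivity
  simp_rw [L1_eq_sum, Finset.mul_sum, Finset.sum_div, Finset.sum_mul, Finset.mul_sum]
  rw [Finset.sum_comm]
  refine Finset.sum_congr rfl fun v _ => ?_
  rw [Finset.sum_eq_single (x.1 v)]
  · simp; field_simp
  · intro b _ hb
    simp [hb.symm]
  · simp

theorem sum_L1 [Fintype 𝒳] [DecidableEq 𝒳] {n : ℕ} (hn : 0 < n)
    (x : (Fin n → 𝒳) × Finset (Fin n × Fin n)) :
    ∑ b, L1 n x b = 1 := by
  have := sum_comp_eq_mul_sum_L1 hn x fun _ => 1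
  have hn' : (n : ℝ) ≠ 0 := by positivity
  simpa [hn'] using this.symm

theorem L_mem_MSpace [Fintype 𝒳] [DecidableEq 𝒳] {n : ℕ} (hn : 0 < n) {an : ℝ} (han : 0 < an)
    (x : (Fin n → 𝒳) × Finset (Fin n × Fin n)) : (L1 n x, L2 an n x) ∈ MSpace 𝒳 := by
  refine ⟨L1_nonneg n x, sum_L1 hn x, fun q => ?_, fun b c => ?_⟩
  · refine div_nonneg (Finset.sum_nonneg fun e _ => ?_) (by positivity)
    split_ifs <;> norm_num
  · simp only [L2]
    congr 1
    refine Finset.sum_congr rfl fun e _ => ?_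
    rw [add_comm]
    simp only [Prod.mk.injEq, and_comm]

theorem sum_pairCount [DecidableEq 𝒳] {n : ℕ} (x : (Fin n → 𝒳) × Finset (Fin n × Fin n))
    (q : 𝒳 × 𝒳) :
    ∑ e ∈ Edges n, pairCount x.1 q e =
      (∑ v, if x.1 v = q.1 then (1:ℝ) else 0) * (∑ v, if x.1 v = q.2 then (1:ℝ) else 0) -
      if q.1 = q.2 then (∑ v, if x.1 v = q.1 then (1:ℝ) else 0) else 0 := by
  have hsplit : ∑ e ∈ Edges n, pairCount x.1 q e =
      (∑ u, ∑ v, if u < v then (if (x.1 u, x.1 v) = q then (1:ℝ) else 0) else 0) +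
      ∑ u, ∑ v, if v < u then (if (x.1 u, x.1 v) = q then (1:ℝ) else 0) else 0 := by
    rw [Finset.sum_filter, Fintype.sum_prod_type]
    conv_rhs => rw [add_comm, Finset.sum_comm, add_comm]
    simp_rw [← Finset.sum_add_distrib]
    refine Finset.sum_congr rfl fun u _ => Finset.sum_congr rfl fun v _ => ?_
    by_cases h : u < v <;> simp [h, pairCount]
  rw [hsplit, Finset.sum_mul_sum]
  have hdiag : (if q.1 = q.2 then (∑ v, if x.1 v = q.1 then (1:ℝ) else 0) else 0) =
      ∑ u, ∑ v, if u = v then (if (x.1 u, x.1 v) = q then (1:ℝ) else 0) else 0 := by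
    simp only [Finset.sum_ite_eq, Finset.mem_univ, if_true]
    obtain ⟨b, c⟩ := q
    by_cases h : b = c
    · subst h; simp
    · simp only [h, if_false]
      symm
      refine Finset.sum_eq_zero fun u _ => if_neg ?_
      simp only [Prod.mk.injEq]
      rintro ⟨h1, h2⟩
      exact h (h1.symm.trans h2)
  rw [hdiag, eq_sub_iff_add_eq]
  simp_rw [← Finset.sum_add_distrib]
  refine Finset.sum_congr rfl fun u _ => Finset.sum_congr rfl fun v _ => ?_
  have hq : (if (x.1 u, x.1 v) = q then (1:ℝ) else 0) =
      (if x.1 u = q.1 then 1 else 0) * (if x.1 v = q.2 then 1 else 0) := by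
    obtain ⟨b, c⟩ := q
    by_cases h1 : x.1 u = b <;> by_cases h2 : x.1 v = c <;> simp [h1, h2]
  rw [← hq]
  rcases lt_trichotomy u v with h | h | h
  · simp [h, h.not_gt, h.ne]
  · simp [h]
  · simp [h, h.not_gt, h.ne']

/-- The fraction of ordered pairs of distinct vertices with colours `q`. -/
def pairFraction [DecidableEq 𝒳] (n : ℕ) (x : (Fin n → 𝒳) × Finset (Fin n × Fin n)) (q : 𝒳 × 𝒳) : ℝ
    :=
  L1 n x q.1 * L1 n x q.2 - if q.1 = q.2 then L1 n x q.1 / n else 0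

theorem sum_pairCount_eq_pairFraction [DecidableEq 𝒳] {n : ℕ} (hn : 0 < n)
    (x : (Fin n → 𝒳) × Finset (Fin n × Fin n)) (q : 𝒳 × 𝒳) :
    ∑ e ∈ Edges n, pairCount x.1 q e = (n:ℝ) ^ 2 * pairFraction n x q := by
  have hn' : (n : ℝ) ≠ 0 := by positivity
  rw [sum_pairCount, pairFraction, L1_eq_sum, L1_eq_sum]
  split_ifs
  · field_simp
  · rw [sub_zero, sub_zero]
    field_simp

theorem pairCount_nonneg [DecidableEq 𝒳] {n : ℕ} (σ : Fin n → 𝒳) (q : 𝒳 × 𝒳) (e : Fin n × Fin n) :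
    0 ≤ pairCount σ q e := by
  unfold pairCount; split_ifs <;> norm_num

theorem pairCount_le_two [DecidableEq 𝒳] {n : ℕ} (σ : Fin n → 𝒳) (q : 𝒳 × 𝒳) (e : Fin n × Fin n) :
    pairCount σ q e ≤ 2 := by
  unfold pairCount; split_ifs <;> norm_num

theorem pairFraction_le_one [DecidableEq 𝒳] (n : ℕ) (x : (Fin n → 𝒳) × Finset (Fin n × Fin n))
    (q : 𝒳 × 𝒳) :
    pairFraction n x q ≤ 1 := by
  have h : 0 ≤ if q.1 = q.2 then L1 n x q.1 / n else 0 := by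
    split_ifs
    · exact div_nonneg (L1_nonneg n x _) (Nat.cast_nonneg n)
    · exact le_rfl
  unfold pairFraction
  nlinarith [L1_nonneg n x q.1, L1_nonneg n x q.2, L1_le_one n x q.1, L1_le_one n x q.2]

theorem pairFraction_nonneg [DecidableEq 𝒳] {n : ℕ} (hn : 0 < n)
    (x : (Fin n → 𝒳) × Finset (Fin n × Fin n)) (q : 𝒳 × 𝒳) : 0 ≤ pairFraction n x q := by
  have h := Finset.sum_nonneg fun e (_ : e ∈ Edges n) => pairCount_nonneg x.1 q e
  rw [sum_pairCount_eq_pairFraction hn] at h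
  exact nonneg_of_mul_nonneg_right h (by positivity)

theorem abs_pairFraction_sub_le [DecidableEq 𝒳] {n : ℕ} (x : (Fin n → 𝒳) × Finset (Fin n × Fin n))
    (q : 𝒳 × 𝒳) {ω : 𝒳 → ℝ} (hω0 : ∀ b, 0 ≤ ω b) (hω1 : ∀ b, ω b ≤ 1) {δ : ℝ}
    (hδ : ∀ b, |L1 n x b - ω b| ≤ δ) :
    |pairFraction n x q - ω q.1 * ω q.2| ≤ 2 * δ + 1 / n := by
  have h : |if q.1 = q.2 then L1 n x q.1 / n else 0| ≤ 1 / (n:ℝ) := by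
    split_ifs
    · rw [abs_of_nonneg (div_nonneg (L1_nonneg n x _) (Nat.cast_nonneg n))]
      exact div_le_div_of_nonneg_right (L1_le_one n x _) (Nat.cast_nonneg n)
    · simp
  have h1 : |(L1 n x q.1 - ω q.1) * L1 n x q.2| ≤ δ := by
    rw [abs_mul, abs_of_nonneg (L1_nonneg n x q.2)]
    exact (mul_le_of_le_one_right (abs_nonneg _) (L1_le_one n x _)).trans (hδ _)
  have h2 : |ω q.1 * (L1 n x q.2 - ω q.2)| ≤ δ := by
    rw [abs_mul, abs_of_nonneg (hω0 q.1)]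
    exact (mul_le_of_le_one_left (abs_nonneg _) (hω1 _)).trans (hδ _)
  unfold pairFraction
  rw [abs_le] at *
  constructor <;> nlinarith

/-- Conditionally on the colours, `L²(q)` has mean `p(q)/aₙ` times the pair fraction, and its
variance is of order `1/(n² aₙ)`. -/
theorem L2_variance_le [DecidableEq 𝒳] {n : ℕ} (hn : 0 < n) {an : ℝ} (han : 0 < an) (p : 𝒳 → 𝒳 → ℝ)
    (hp0 : ∀ b c, 0 ≤ p b c) (hpsymm : ∀ b c, p b c = p c b)
    (σ : Fin n → 𝒳) (q : 𝒳 × 𝒳) :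
    ∑ E ∈ (Edges n).powerset, (∏ e ∈ Edges n,
        (if e ∈ E then p (σ e.1) (σ e.2) else 1 - p (σ e.1) (σ e.2))) *
      (L2 an n (σ, E) q - p q.1 q.2 / an * pairFraction n (σ, ∅) q) ^ 2 ≤
    2 * (p q.1 q.2 / an) / ((n:ℝ) * (n * an)) := by
  have hn' : (n : ℝ) ≠ 0 := by positivity
  have hpg (e : Fin n × Fin n) :
      p (σ e.1) (σ e.2) * pairCount σ q e = p q.1 q.2 * pairCount σ q e := by
    unfold pairCount
    by_cases h1 : (σ e.1, σ e.2) = q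
    · rw [← h1]
    · by_cases h2 : (σ e.2, σ e.1) = q
      · rw [← h2, hpsymm]
      · simp [h1, h2]
  have hsum := sum_pairCount_eq_pairFraction hn (σ, ∅) q
  simp only at hsum
  have hvar := (bernoulli_moments (fun e : Fin n × Fin n => p (σ e.1) (σ e.2))
    (pairCount σ q) (Edges n)).2.2
  simp only [hpg, ← Finset.mul_sum, hsum] at hvar
  have hrew (E : Finset (Fin n × Fin n)) :
      L2 an n (σ, E) q - p q.1 q.2 / an * pairFraction n (σ, ∅) q =
      (∑ e ∈ E, pairCount σ q e - p q.1 q.2 * ((n:ℝ) ^ 2 * pairFraction n (σ, ∅) q)) /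
        ((n:ℝ) ^ 2 * an) := by
    unfold L2 pairCount
    field_simp
  simp_rw [hrew, div_pow, ← mul_div_assoc]
  rw [← Finset.sum_div, hvar]
  have hb : ∑ e ∈ Edges n, p (σ e.1) (σ e.2) * (1 - p (σ e.1) (σ e.2)) * pairCount σ q e ^ 2 ≤
      2 * p q.1 q.2 * (n:ℝ) ^ 2 := by
    calc _ ≤ ∑ e ∈ Edges n, 2 * p q.1 q.2 * pairCount σ q e := by
          refine Finset.sum_le_sum fun e _ => ?_
          have h0 := pairCount_nonneg σ q e
          have h2 := pairCount_le_two σ q e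
          have hp := hp0 (σ e.1) (σ e.2)
          have : p (σ e.1) (σ e.2) * (1 - p (σ e.1) (σ e.2)) * pairCount σ q e ^ 2 ≤
              2 * (p (σ e.1) (σ e.2) * pairCount σ q e) := by
            nlinarith [mul_nonneg hp h0, mul_nonneg (mul_nonneg hp h0) (sub_nonneg.2 h2),
              mul_nonneg (mul_nonneg hp hp) (mul_nonneg h0 h0)]
          rw [hpg] at this
          linarith
      _ = 2 * p q.1 q.2 * ((n:ℝ) ^ 2 * pairFraction n (σ, ∅) q) := by
          rw [← Finset.mul_sum, hsum]
      _ ≤ _ := by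
          have := pairFraction_le_one n (σ, ∅) q
          have h2 := hp0 q.1 q.2
          gcongr
          exact mul_le_of_le_one_right (by positivity) this
  calc _ ≤ 2 * p q.1 q.2 * (n:ℝ) ^ 2 / ((n:ℝ) ^ 2 * an) ^ 2 := by gcongr
    _ = _ := by field_simp

/-- The colours and pairs of the `ω`-coloured random graph concentrate around `ω` and
`Cω⊗ω`: a quantitative weak law of large numbers. -/
theorem eventually_quarter_le_graphPr [Fintype 𝒳] [DecidableEq 𝒳] {ω : 𝒳 → ℝ} (hω0 : ∀ b, 0 ≤ ω b)
    (hωs : ∑ b, ω b = 1)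
    {p : ℕ → 𝒳 → 𝒳 → ℝ} (hp0 : ∀ n b c, 0 ≤ p n b c) (hp1 : ∀ n b c, p n b c ≤ 1)
    (hpsymm : ∀ n b c, p n b c = p n c b)
    {C : 𝒳 → 𝒳 → ℝ} (hC0 : ∀ b c, 0 ≤ C b c) {a : ℕ → ℝ} (hapos : ∀ n, 0 < a n)
    (hconv : ∀ i j, Tendsto (fun n => p n i j / a n) atTop (nhds (C i j)))
    (hna : Tendsto (fun n : ℕ => (n : ℝ) * a n) atTop atTop) {ε : ℝ} (hε : 0 < ε) :
    ∀ᶠ n : ℕ in atTop, 1 / 4 ≤ graphPr ω (p n) n {x | (∀ b, |L1 n x b - ω b| < ε) ∧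
      ∀ q : 𝒳 × 𝒳, |L2 (a n) n x q - C q.1 q.2 * ω q.1 * ω q.2| < ε} := by
  have hω1 (b : 𝒳) : ω b ≤ 1 :=
    hωs ▸ Finset.single_le_sum (fun c _ => hω0 c) (Finset.mem_univ b)
  set K : ℝ := 1 + ∑ q : 𝒳 × 𝒳, C q.1 q.2
  have hCK (q : 𝒳 × 𝒳) : C q.1 q.2 ≤ K := by
    have := Finset.single_le_sum (f := fun q : 𝒳 × 𝒳 => C q.1 q.2) (fun c _ => hC0 c.1 c.2)
      (Finset.mem_univ q)
    linarith
  have hKpos : 0 < K := by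
    have := Finset.sum_nonneg (s := Finset.univ) fun (q : 𝒳 × 𝒳) _ => hC0 q.1 q.2
    linarith
  set δ : ℝ := min ε (ε / (16 * K))
  have hδ : 0 < δ := lt_min hε (by positivity)
  have hn1 : Tendsto (fun n : ℕ => 1 / (n:ℝ)) atTop (nhds 0) :=
    tendsto_one_div_atTop_nhds_zero_nat
  have hnn : Tendsto (fun n : ℕ => (n:ℝ) * (n * a n)) atTop atTop :=
    tendsto_natCast_atTop_atTop.atTop_mul_atTop₀ hna
  have hvarlim : Tendsto (fun n : ℕ => (∑ q : 𝒳 × 𝒳,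
      2 * (p n q.1 q.2 / a n) / ((n:ℝ) * (n * a n))) / (ε / 2) ^ 2) atTop (nhds 0) := by
    have : Tendsto (fun n : ℕ => (∑ q : 𝒳 × 𝒳,
        2 * (p n q.1 q.2 / a n) / ((n:ℝ) * (n * a n))) / (ε / 2) ^ 2) atTop
        (nhds ((∑ _q : 𝒳 × 𝒳, (0:ℝ)) / (ε / 2) ^ 2)) :=
      (tendsto_finsetSum _ fun q _ =>
        ((hconv q.1 q.2).const_mul 2).div_atTop hnn).div_const _
    simpa using this
  have hcollim : Tendsto (fun n : ℕ => (∑ _b : 𝒳, 1 / (n:ℝ)) / δ ^ 2) atTop (nhds 0) := by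
    have : Tendsto (fun n : ℕ => (∑ _b : 𝒳, 1 / (n:ℝ)) / δ ^ 2) atTop
        (nhds ((∑ _b : 𝒳, (0:ℝ)) / δ ^ 2)) :=
      (tendsto_finsetSum _ fun _ _ => hn1).div_const _
    simpa using this
  have hpC : ∀ᶠ n : ℕ in atTop, ∀ q : 𝒳 × 𝒳, |p n q.1 q.2 / a n - C q.1 q.2| < ε / 8 :=
    eventually_all.2 fun q => (Metric.tendsto_nhds.1 (hconv q.1 q.2) (ε / 8) (by positivity))
  filter_upwards [eventually_gt_atTop 0, hpC,
    hvarlim.eventually_le_const (by norm_num : (0:ℝ) < 1 / 2),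
    hcollim.eventually_le_const (by norm_num : (0:ℝ) < 1 / 2),
    hn1.eventually_le_const (by positivity : 0 < ε / (8 * K))] with n hn hpn hvar hcol hnK
  have hn' : (n : ℝ) ≠ 0 := by positivity
  set S : Set ((Fin n → 𝒳) × Finset (Fin n × Fin n)) := {x | (∀ b, |L1 n x b - ω b| < ε) ∧
      ∀ q : 𝒳 × 𝒳, |L2 (a n) n x q - C q.1 q.2 * ω q.1 * ω q.2| < ε}
  rw [graphPr_eq_sum]
  set G : Set (Fin n → 𝒳) := {σ | ∀ b, |L1 n (σ, ∅) b - ω b| < δ}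
  have hwpos (σ : Fin n → 𝒳) : 0 ≤ ∏ v, ω (σ v) := Finset.prod_nonneg fun v _ => hω0 _
  have hWpos (σ : Fin n → 𝒳) (E : Finset (Fin n × Fin n)) : 0 ≤ ∏ e ∈ Edges n,
        (if e ∈ E then p n (σ e.1) (σ e.2) else 1 - p n (σ e.1) (σ e.2)) :=
    Finset.prod_nonneg fun e _ => by
      split_ifs
      · exact hp0 _ _ _
      · exact sub_nonneg.2 (hp1 _ _ _)
  have hedges : ∀ σ ∈ G, 1 / 2 ≤ ∑ E ∈ (Edges n).powerset,
      {E | (σ, E) ∈ S}.indicator (fun E => ∏ e ∈ Edges n,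
        (if e ∈ E then p n (σ e.1) (σ e.2) else 1 - p n (σ e.1) (σ e.2))) E := by
    intro σ hσ
    refine le_trans (by linarith) (one_sub_le_sum_of_sq_le (Edges n).powerset _
      (fun E _ => hWpos σ E)
      (bernoulli_moments (fun e : Fin n × Fin n => p n (σ e.1) (σ e.2)) 0 (Edges n)).1
      (fun (q : 𝒳 × 𝒳) E =>
        L2 (a n) n (σ, E) q - p n q.1 q.2 / a n * pairFraction n (σ, ∅) q)
      _ (fun q => L2_variance_le hn (hapos n) (p n) (hp0 n) (hpsymm n) σ q)
      (half_pos hε) {E | (σ, E) ∈ S} fun E _ hE => ⟨fun b => ?_, fun q => ?_⟩)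
    · exact (hσ b).trans_le (min_le_left _ _)
    · have hf := abs_pairFraction_sub_le (σ, ∅) q hω0 hω1 fun b => (hσ b).le
      have hf0 := pairFraction_nonneg hn (σ, ∅) q
      have hf1 := pairFraction_le_one n (σ, ∅) q
      have h1 : |(p n q.1 q.2 / a n - C q.1 q.2) * pairFraction n (σ, ∅) q| ≤ ε / 8 := by
        rw [abs_mul, abs_of_nonneg hf0]
        exact (mul_le_of_le_one_right (abs_nonneg _) hf1).trans (hpn q).le
      have h2 : |C q.1 q.2 * (pairFraction n (σ, ∅) q - ω q.1 * ω q.2)| ≤ ε / 4 := by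
        rw [abs_mul, abs_of_nonneg (hC0 _ _)]
        calc _ ≤ K * (2 * (ε / (16 * K)) + ε / (8 * K)) :=
              mul_le_mul (hCK q) (hf.trans (add_le_add
                (mul_le_mul_of_nonneg_left (min_le_right _ _) zero_le_two) hnK))
                (abs_nonneg _) hKpos.le
          _ = ε / 4 := by field_simp; norm_num
      have h3 := hE q
      rw [abs_le] at h1 h2
      rw [abs_lt] at h3 ⊢
      constructor <;> linarith
  have hcolours : 1 / 2 ≤ ∑ σ, G.indicator (fun σ => ∏ v, ω (σ v)) σ := by
    refine le_trans (by linarith) (one_sub_le_sum_of_sq_le Finset.univ _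
      (fun σ _ => hwpos σ)
      (iid_moments ω 0 hωs (by simp) n).1
      (fun (b : 𝒳) σ => L1 n (σ, ∅) b - ω b)
      (fun _ => 1 / (n:ℝ)) (fun b => ?_) hδ G fun σ _ h => h)
    have hmean : ∑ c, ω c * ((if c = b then (1:ℝ) else 0) - ω b) = 0 := by
      simp [mul_sub, ← Finset.sum_mul, hωs]
    have hm := (iid_moments ω (fun c => (if c = b then (1:ℝ) else 0) - ω b) hωs hmean n).2.2
    have hrew (σ : Fin n → 𝒳) : L1 n (σ, ∅) b - ω b =
        (∑ v, ((if σ v = b then (1:ℝ) else 0) - ω b)) / n := by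
      rw [L1_eq_sum, Finset.sum_sub_distrib]
      simp only [Finset.sum_const, Finset.card_univ, Fintype.card_fin, nsmul_eq_mul]
      field_simp
    simp_rw [hrew, div_pow, ← mul_div_assoc]
    rw [← Finset.sum_div, hm]
    have hle : ∑ c, ω c * ((if c = b then (1:ℝ) else 0) - ω b) ^ 2 ≤ 1 := by
      rw [← hωs]
      refine Finset.sum_le_sum fun c _ => mul_le_of_le_one_right (hω0 c) ?_
      have h0 := hω0 b
      have h1 := hω1 b
      split_ifs <;> nlinarith
    calc _ ≤ (n:ℝ) * 1 / (n:ℝ) ^ 2 := by gcongr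
      _ = _ := by field_simp
  calc (1:ℝ) / 4 = 1 / 2 * (1 / 2) := by norm_num
    _ ≤ (∑ σ, G.indicator (fun σ => ∏ v, ω (σ v)) σ) * (1 / 2) := by gcongr
    _ ≤ _ := by
      rw [Finset.sum_mul]
      refine Finset.sum_le_sum fun σ _ => ?_
      by_cases hσ : σ ∈ G
      · rw [Set.indicator_of_mem hσ]
        exact mul_le_mul_of_nonneg_left (hedges σ hσ) (hwpos σ)
      · rw [Set.indicator_of_notMem hσ, zero_mul]
        exact mul_nonneg (hwpos σ) (Finset.sum_nonneg fun E _ =>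
          Set.indicator_nonneg (fun E _ => hWpos σ E) E)

/-- Exponential change of the colour law from `ω` to `μ`. -/
theorem exp_mul_graphPr_le [Fintype 𝒳] [DecidableEq 𝒳] {μ ω : 𝒳 → ℝ} (hμ0 : ∀ b, 0 < μ b)
    (hω0 : ∀ b, 0 ≤ ω b)
    {p : 𝒳 → 𝒳 → ℝ} (hp0 : ∀ b c, 0 ≤ p b c) (hp1 : ∀ b c, p b c ≤ 1) {n : ℕ} (hn : 0 < n)
    {S : Set ((Fin n → 𝒳) × Finset (Fin n × Fin n))} {δ : ℝ}
    (hS : ∀ x ∈ S, ∀ b, |L1 n x b - ω b| ≤ δ) :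
    Real.exp (-(n * (∑ b, ω b * Real.log (ω b / μ b) + δ * ∑ b, |Real.log (ω b / μ b)|))) *
      graphPr ω p n S ≤ graphPr μ p n S := by
  unfold graphPr
  rw [Finset.mul_sum]
  refine Finset.sum_le_sum fun x _ => ?_
  by_cases hx : x ∈ S
  swap
  · simp [hx]
  rw [Set.indicator_of_mem hx, Set.indicator_of_mem hx, graphWeight, graphWeight]
  have hW : 0 ≤ ∏ e ∈ Edges n,
      (if e ∈ x.2 then p (x.1 e.1) (x.1 e.2) else 1 - p (x.1 e.1) (x.1 e.2)) :=
    Finset.prod_nonneg fun e _ => by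
      split_ifs
      · exact hp0 _ _
      · exact sub_nonneg.2 (hp1 _ _)
  have key : Real.exp (-(n * (∑ b, ω b * Real.log (ω b / μ b) +
      δ * ∑ b, |Real.log (ω b / μ b)|))) * ∏ v, ω (x.1 v) ≤ ∏ v, μ (x.1 v) := by
    have hμp : 0 < ∏ v, μ (x.1 v) := Finset.prod_pos fun v _ => hμ0 _
    by_cases h0 : ∃ v, ω (x.1 v) = 0
    · obtain ⟨v, hv⟩ := h0
      rw [Finset.prod_eq_zero (Finset.mem_univ v) hv, mul_zero]
      exact hμp.le
    push Not at h0
    have hprod : ∏ v, ω (x.1 v) =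
        Real.exp (∑ v, Real.log (ω (x.1 v) / μ (x.1 v))) * ∏ v, μ (x.1 v) := by
      rw [Real.exp_sum, ← Finset.prod_mul_distrib]
      refine Finset.prod_congr rfl fun v _ => ?_
      have := hμ0 (x.1 v)
      rw [Real.exp_log (div_pos ((hω0 _).lt_of_ne' (h0 v)) this)]
      field_simp
    rw [hprod, ← mul_assoc, ← Real.exp_add]
    refine mul_le_of_le_one_left hμp.le (Real.exp_le_one_iff.2 ?_)
    rw [sum_comp_eq_mul_sum_L1 hn x fun b => Real.log (ω b / μ b), neg_add_nonpos_iff]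
    gcongr
    rw [Finset.mul_sum, ← Finset.sum_add_distrib]
    refine Finset.sum_le_sum fun b _ => ?_
    have h1 : (L1 n x b - ω b) * Real.log (ω b / μ b) ≤ δ * |Real.log (ω b / μ b)| :=
      (le_abs_self _).trans
        ((abs_mul _ _).trans_le (mul_le_mul_of_nonneg_right (hS x hx b) (abs_nonneg _)))
    linarith
  calc _ = (if x.2 ⊆ Edges n then (1:ℝ) else 0) * (Real.exp (-(n * (∑ b, ω b *
        Real.log (ω b / μ b) + δ * ∑ b, |Real.log (ω b / μ b)|))) * ∏ v, ω (x.1 v)) *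
        ∏ e ∈ Edges n,
          (if e ∈ x.2 then p (x.1 e.1) (x.1 e.2) else 1 - p (x.1 e.1) (x.1 e.2)) := by ring
    _ ≤ _ := by
      refine mul_le_mul_of_nonneg_right (mul_le_mul_of_nonneg_left key ?_) hW
      split_ifs <;> norm_num

theorem graphPr_mono [Fintype 𝒳] {μ : 𝒳 → ℝ} (hμ0 : ∀ b, 0 ≤ μ b) {p : 𝒳 → 𝒳 → ℝ}
    (hp0 : ∀ b c, 0 ≤ p b c) (hp1 : ∀ b c, p b c ≤ 1) {n : ℕ}
    {S T : Set ((Fin n → 𝒳) × Finset (Fin n × Fin n))} (hST : S ⊆ T) :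
    graphPr μ p n S ≤ graphPr μ p n T := by
  refine Finset.sum_le_sum fun x _ => Set.indicator_le_indicator_of_subset hST (fun x => ?_) x
  unfold graphWeight
  refine mul_nonneg (mul_nonneg ?_ (Finset.prod_nonneg fun v _ => hμ0 _))
    (Finset.prod_nonneg fun e _ => ?_)
  · split_ifs <;> norm_num
  · split_ifs
    · exact hp0 _ _
    · exact sub_nonneg.2 (hp1 _ _)

end CRG

/-- **Lower bound in Theorem 2.4(ii)** (Lemma 3.7): for the supercritical coloured random
graph, for every open subset `O = U ∩ (ℳ(𝒳) × ℳ̃_*(𝒳×𝒳))` of the subspace,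
`liminf (1/n) log ℙ{(L¹,L²) ∈ O} ≥ −inf_O I₂`. -/
theorem lower_bound_speed_n_supercritical
    {𝒳 : Type} [Fintype 𝒳] [DecidableEq 𝒳] [Nonempty 𝒳]
    (μ : 𝒳 → ℝ) (hμ0 : ∀ a, 0 < μ a) (hμ1 : ∀ a, μ a ≤ 1) (hμs : ∑ a, μ a = 1)
    (p : ℕ → 𝒳 → 𝒳 → ℝ) (hp0 : ∀ n a b, 0 ≤ p n a b) (hp1 : ∀ n a b, p n a b ≤ 1)
    (hpsymm : ∀ n a b, p n a b = p n b a)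
    (C : 𝒳 → 𝒳 → ℝ) (hC0 : ∀ a b, 0 ≤ C a b) (hCsymm : ∀ a b, C a b = C b a)
    (a : ℕ → ℝ) (hapos : ∀ n, 0 < a n)
    (hconv : ∀ i j, Filter.Tendsto (fun n => p n i j / a n) Filter.atTop (nhds (C i j)))
    (ha0 : Filter.Tendsto a Filter.atTop (nhds 0))
    (hna : Filter.Tendsto (fun n : ℕ => (n : ℝ) * a n) Filter.atTop Filter.atTop)
    :
    ∀ U : Set ((𝒳 → ℝ) × (𝒳 × 𝒳 → ℝ)), IsOpen U →
      - ⨅ z ∈ U ∩ MSpace 𝒳, (I2 μ C z : EReal)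
        ≤ Filter.liminf (fun n : ℕ => ((1 / (n:ℝ) : ℝ) : EReal) *
          elog (graphPr μ (p n) n {x | (L1 n x, L2 (a n) n x) ∈ U ∩ MSpace 𝒳})) Filter.atTop := by
  intro U hU
  rw [EReal.neg_le]
  refine le_iInf₂ fun z hz => ?_
  rw [EReal.neg_le]
  obtain ⟨hzU, hω0, hωs, -, -⟩ := hz
  unfold I2
  split_ifs with hz2
  swap
  · simp
  rw [relEnt, if_pos fun x hx => absurd hx (hμ0 x).ne']
  set H : ℝ := ∑ x, z.1 x * Real.log (z.1 x / μ x)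
  set Λ : ℝ := ∑ x, |Real.log (z.1 x / μ x)|
  have hΛ0 : 0 ≤ Λ := Finset.sum_nonneg fun _ _ => abs_nonneg _
  have hHle : -((ENNReal.ofReal H : ℝ≥0∞) : EReal) ≤ ((-H : ℝ) : EReal) := by
    rw [EReal.coe_neg, EReal.neg_le_neg_iff, EReal.coe_ennreal_ofReal]
    exact_mod_cast le_max_left H 0
  refine hHle.trans (le_of_forall_lt fun c hc => ?_)
  obtain ⟨r, hcr, hr⟩ := EReal.lt_iff_exists_real_btwn.1 hc
  refine hcr.trans_le (Filter.le_liminf_of_le (by isBoundedDefault) ?_)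
  have hη : 0 < -H - r := by
    have : r < -H := by exact_mod_cast hr
    linarith
  obtain ⟨ε₀, hε₀, hball⟩ := Metric.isOpen_iff.1 hU z hzU
  set ε : ℝ := min ε₀ ((-H - r) / (2 * (Λ + 1)))
  have hε : 0 < ε := lt_min hε₀ (by positivity)
  have hεΛ : ε * Λ ≤ (-H - r) / 2 :=
    calc ε * Λ ≤ (-H - r) / (2 * (Λ + 1)) * (Λ + 1) :=
          mul_le_mul (min_le_right _ _) (by linarith) hΛ0 (by positivity)
      _ = (-H - r) / 2 := by field_simp
  have hlog : Filter.Tendsto (fun n : ℕ => 1 / (n:ℝ) * Real.log (1 / 4)) Filter.atTop (nhds 0) := by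
    simpa using tendsto_one_div_atTop_nhds_zero_nat.mul_const (Real.log (1 / 4))
  filter_upwards [Filter.eventually_gt_atTop 0,
    eventually_quarter_le_graphPr hω0 hωs hp0 hp1 hpsymm hC0 hapos hconv hna hε,
    hlog.eventually_const_le (by linarith : -((-H - r) / 2) < 0)] with n hn hPr hlogn
  have hnpos : (0:ℝ) < n := by positivity
  have hsub : {x | (∀ b, |L1 n x b - z.1 b| < ε) ∧
      ∀ q : 𝒳 × 𝒳, |L2 (a n) n x q - C q.1 q.2 * z.1 q.1 * z.1 q.2| < ε} ⊆
      {x | (L1 n x, L2 (a n) n x) ∈ U ∩ MSpace 𝒳} := by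
    rintro x ⟨hx1, hx2⟩
    refine ⟨hball ?_, L_mem_MSpace hn (hapos n) x⟩
    rw [Metric.mem_ball, Prod.dist_eq]
    refine (max_lt ((dist_pi_lt_iff hε).2 hx1) ((dist_pi_lt_iff hε).2 fun q => ?_)).trans_le
      (min_le_left _ _)
    rw [hz2]
    exact hx2 q
  have hlower : Real.exp (-(n * (H + ε * Λ))) * (1 / 4) ≤
      graphPr μ (p n) n {x | (L1 n x, L2 (a n) n x) ∈ U ∩ MSpace 𝒳} :=
    calc _ ≤ _ := mul_le_mul_of_nonneg_left hPr (Real.exp_pos _).le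
      _ ≤ _ := exp_mul_graphPr_le hμ0 hω0 (hp0 n) (hp1 n) hn fun x hx b => (hx.1 b).le
      _ ≤ _ := graphPr_mono (fun b => (hμ0 b).le) (hp0 n) (hp1 n) hsub
  have hpos : 0 < Real.exp (-(n * (H + ε * Λ))) * (1 / 4) := by positivity
  rw [elog, if_neg (hpos.trans_le hlower).not_ge]
  norm_cast
  have hl := Real.log_le_log hpos hlower
  rw [Real.log_mul (Real.exp_pos _).ne' (by norm_num), Real.log_exp] at hl
  have := mul_le_mul_of_nonneg_left hl (by positivity : 0 ≤ 1 / (n:ℝ))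
  refine le_trans ?_ this
  rw [mul_add, show 1 / (n:ℝ) * -(n * (H + ε * Λ)) = -(H + ε * Λ) by field_simp]
  linarith
end
end

section
/- Let X be a coloured random graph with colour law μ : 𝒳 → (0,1] and connection probabilities p_n satisfying a_n^{-1}·p_n(a,b) → C(a,b) for all a,b ∈ 𝒳, for some symmetric C : 𝒳×𝒳 → [0,∞) and a sequence (a_n) with a_n → 0 and n·a_n → ∞. Define, for a probability measure ω on 𝒳 and a finite symmetric measure ϖ on 𝒳×𝒳, Î₁(ω,ϖ) = sup over symmetric functions g : 𝒳×𝒳 → ℝ of [ (1/2)·Σ_{a,b∈𝒳} g(a,b)·ϖ(a,b) + (1/2)·Σ_{a,b∈𝒳} (1 − e^{g(a,b)})·C(a,b)·ω(a)·ω(b) ]. Then for every closed set F ⊂ ℳ(𝒳)×ℳ̃_*(𝒳×𝒳), limsup_{n→∞} (1/(a_n·n²))·log ℙ{ (L¹, L²) ∈ F } ≤ −inf_{(ω,ϖ)∈F} Î₁(ω,ϖ). -/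
open Filter
open scoped ENNReal

noncomputable section

open CRG

/-- The variational functional `Î₁(ω,ϖ)` of Lemma 3.8: supremum over symmetric
`g : 𝒳×𝒳 → ℝ` of `½ Σ g ϖ + ½ Σ (1 − e^g) Cω⊗ω`. -/
def Ihat1 {𝒳 : Type} [Fintype 𝒳] (C : 𝒳 → 𝒳 → ℝ)
    (ω : 𝒳 → ℝ) (ϖ : 𝒳 × 𝒳 → ℝ) : EReal :=
  ⨆ (g : 𝒳 × 𝒳 → ℝ), ⨆ (_ : ∀ i j, g (i,j) = g (j,i)),
    (((1/2) * ∑ q : 𝒳 × 𝒳, g q * ϖ q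
      + (1/2) * ∑ q : 𝒳 × 𝒳, (1 - Real.exp (g q)) * (C q.1 q.2 * ω q.1 * ω q.2) : ℝ) : EReal)

namespace CRG

/-- The functional whose supremum over symmetric `g` is `Ihat1`. -/
def tiltFunctional {𝒳 : Type} [Fintype 𝒳] (C : 𝒳 → 𝒳 → ℝ) (g : 𝒳 × 𝒳 → ℝ)
    (z : (𝒳 → ℝ) × (𝒳 × 𝒳 → ℝ)) : ℝ :=
  (1/2) * ∑ q : 𝒳 × 𝒳, g q * z.2 q
    + (1/2) * ∑ q : 𝒳 × 𝒳, (1 - Real.exp (g q)) * (C q.1 q.2 * z.1 q.1 * z.1 q.2)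

lemma continuous_tiltFunctional {𝒳 : Type} [Fintype 𝒳] (C : 𝒳 → 𝒳 → ℝ) (g : 𝒳 × 𝒳 → ℝ) :
    Continuous (tiltFunctional C g) := by
  unfold tiltFunctional
  fun_prop

lemma exists_tiltFunctional_gt {𝒳 : Type} [Fintype 𝒳] {C : 𝒳 → 𝒳 → ℝ}
    {z : (𝒳 → ℝ) × (𝒳 × 𝒳 → ℝ)} {α : ℝ} (h : (α : EReal) < Ihat1 C z.1 z.2) :
    ∃ g : 𝒳 × 𝒳 → ℝ, (∀ i j, g (i, j) = g (j, i)) ∧ α < tiltFunctional C g z := by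
  simp only [Ihat1, lt_iSup_iff] at h
  obtain ⟨g, hg, h⟩ := h
  exact ⟨g, hg, EReal.coe_lt_coe_iff.1 h⟩

/-- The tilt by the constant function `1` is coercive in the pair measure. -/
lemma tiltFunctional_one_ge {𝒳 : Type} [Fintype 𝒳] {C : 𝒳 → 𝒳 → ℝ} (hC0 : ∀ a b, 0 ≤ C a b)
    {z : (𝒳 → ℝ) × (𝒳 × 𝒳 → ℝ)} (hz : z ∈ MSpace 𝒳) :
    (1/2) * ∑ q, z.2 q - Real.exp 1 * ∑ q : 𝒳 × 𝒳, C q.1 q.2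
      ≤ tiltFunctional C (fun _ => 1) z := by
  obtain ⟨h0, h1, -, -⟩ := hz
  have hle : ∀ a, z.1 a ≤ 1 := fun a => by
    rw [← h1]
    exact Finset.single_le_sum (fun i _ => h0 i) (Finset.mem_univ a)
  have hS : ∑ q : 𝒳 × 𝒳, C q.1 q.2 * z.1 q.1 * z.1 q.2 ≤ ∑ q : 𝒳 × 𝒳, C q.1 q.2 := by
    refine Finset.sum_le_sum fun q _ => ?_
    calc C q.1 q.2 * z.1 q.1 * z.1 q.2 ≤ C q.1 q.2 * 1 * 1 := by
          have := hC0 q.1 q.2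
          have := h0 q.1
          have := h0 q.2
          gcongr <;> apply hle
      _ = _ := by ring
  have hS0 : 0 ≤ ∑ q : 𝒳 × 𝒳, C q.1 q.2 * z.1 q.1 * z.1 q.2 :=
    Finset.sum_nonneg fun q _ => mul_nonneg (mul_nonneg (hC0 _ _) (h0 _)) (h0 _)
  have he : 0 < Real.exp 1 := Real.exp_pos 1
  simp only [tiltFunctional, ← Finset.mul_sum, one_mul]
  nlinarith [mul_le_mul_of_nonneg_left hS he.le, mul_nonneg he.le hS0]

/-- A closed set on which `Ihat1` exceeds `α` is covered by finitely many half-space-like sets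
`{α < tiltFunctional C g}`. -/
lemma exists_finset_tilt_cover {𝒳 : Type} [Fintype 𝒳] {C : 𝒳 → 𝒳 → ℝ} (hC0 : ∀ a b, 0 ≤ C a b)
    {F : Set ((𝒳 → ℝ) × (𝒳 × 𝒳 → ℝ))} (hF : F ⊆ MSpace 𝒳) (hFc : IsClosed F) {α : ℝ}
    (hα : ∀ z ∈ F, (α : EReal) < Ihat1 C z.1 z.2) :
    ∃ G : Finset (𝒳 × 𝒳 → ℝ), (∀ g ∈ G, ∀ i j, g (i, j) = g (j, i)) ∧
      ∀ z ∈ F, ∃ g ∈ G, α < tiltFunctional C g z := by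
  classical
  set K : ℝ := 2 * (|α| + 1 + Real.exp 1 * ∑ q : 𝒳 × 𝒳, C q.1 q.2) with hK
  have hcomp : IsCompact (F ∩ {z | ∑ q, z.2 q ≤ K}) := by
    refine IsCompact.of_isClosed_subset
      (isCompact_Icc (a := ((0 : 𝒳 → ℝ), (0 : 𝒳 × 𝒳 → ℝ)))
        (b := ((fun _ => 1 : 𝒳 → ℝ), (fun _ => K : 𝒳 × 𝒳 → ℝ)))) ?_ ?_
    · exact hFc.inter (isClosed_le (by fun_prop) continuous_const)
    · rintro z ⟨hz, hzK⟩
      obtain ⟨h0, h1, h2, -⟩ := hF hz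
      refine ⟨⟨h0, h2⟩, ⟨fun a => ?_, fun q => ?_⟩⟩
      · exact (Finset.single_le_sum (fun i _ => h0 i) (Finset.mem_univ a)).trans h1.le
      · exact (Finset.single_le_sum (fun i _ => h2 i) (Finset.mem_univ q)).trans hzK
  choose! γ hγs hγ using fun z (hz : z ∈ F) => exists_tiltFunctional_gt (hα z hz)
  obtain ⟨t, ht, htc⟩ := hcomp.elim_nhds_subcover
    (fun z => {w | α < tiltFunctional C (γ z) w})
    (fun z hz => (isOpen_lt continuous_const (continuous_tiltFunctional C _)).mem_nhds
      (hγ z hz.1))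
  refine ⟨insert (fun _ => 1) (t.image γ), ?_, fun z hz => ?_⟩
  · intro g hg
    rcases Finset.mem_insert.1 hg with rfl | hg
    · simp
    · obtain ⟨z, hz, rfl⟩ := Finset.mem_image.1 hg
      exact hγs z (ht z hz).1
  · by_cases hzK : ∑ q, z.2 q ≤ K
    · obtain ⟨w, hw, hwz⟩ := Set.mem_iUnion₂.1 (htc ⟨hz, hzK⟩)
      exact ⟨γ w, Finset.mem_insert_of_mem (Finset.mem_image_of_mem γ hw), hwz⟩
    · refine ⟨_, Finset.mem_insert_self _ _, ?_⟩
      have := tiltFunctional_one_ge hC0 (hF hz)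
      have := le_abs_self α
      push Not at hzK
      linarith

lemma graphWeight_nonneg {𝒳 : Type} {μ : 𝒳 → ℝ} (hμ0 : ∀ a, 0 ≤ μ a) {p : 𝒳 → 𝒳 → ℝ}
    (hp0 : ∀ a b, 0 ≤ p a b) (hp1 : ∀ a b, p a b ≤ 1) (n : ℕ)
    (x : (Fin n → 𝒳) × Finset (Fin n × Fin n)) : 0 ≤ graphWeight μ p n x := by
  unfold graphWeight
  refine mul_nonneg (mul_nonneg (by split_ifs <;> norm_num)
    (Finset.prod_nonneg fun _ _ => hμ0 _)) (Finset.prod_nonneg fun e _ => ?_)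
  split_ifs
  · exact hp0 _ _
  · exact sub_nonneg.2 (hp1 _ _)

/-- The error rate in the exponential moment bound for `tiltFunctional`. -/
def tiltError {𝒳 : Type} [Fintype 𝒳] (p C : 𝒳 → 𝒳 → ℝ) (an : ℝ) (g : 𝒳 × 𝒳 → ℝ) (n : ℕ) : ℝ :=
  (∑ q : 𝒳 × 𝒳, |p q.1 q.2 / an - C q.1 q.2|) * (∑ q, |Real.exp (g q) - 1|)
    + (∑ q : 𝒳 × 𝒳, |C q.1 q.2 * (Real.exp (g q) - 1)|) / n

lemma tendsto_tiltError {𝒳 : Type} [Fintype 𝒳] {p : ℕ → 𝒳 → 𝒳 → ℝ} {C : 𝒳 → 𝒳 → ℝ} {a : ℕ → ℝ}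
    (hconv : ∀ i j, Tendsto (fun n => p n i j / a n) atTop (nhds (C i j))) (g : 𝒳 × 𝒳 → ℝ) :
    Tendsto (fun n => tiltError (p n) C (a n) g n) atTop (nhds 0) := by
  unfold tiltError
  have h1 : Tendsto (fun n => ∑ q : 𝒳 × 𝒳, |p n q.1 q.2 / a n - C q.1 q.2|) atTop (nhds 0) := by
    rw [show (0 : ℝ) = ∑ q : 𝒳 × 𝒳, |C q.1 q.2 - C q.1 q.2| by simp]
    exact tendsto_finsetSum _ fun q _ => ((hconv q.1 q.2).sub_const _).abs
  simpa using (h1.mul_const _).add (tendsto_const_div_atTop_nhds_zero_nat _)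

section Moments

variable {𝒳 : Type} [Fintype 𝒳] [DecidableEq 𝒳]

/-- Moment generating function of an edge functional of independent edges. -/
lemma sum_edges_mgf {ι : Type} [Fintype ι] [DecidableEq ι] (s : Finset ι) (p h : ι → ℝ) :
    ∑ E : Finset ι, (if E ⊆ s then (1 : ℝ) else 0) *
        (∏ e ∈ s, if e ∈ E then p e else 1 - p e) * Real.exp (∑ e ∈ E, h e)
      = ∏ e ∈ s, (1 + p e * (Real.exp (h e) - 1)) := by
  have h1 : ∀ e, 1 + p e * (Real.exp (h e) - 1) = p e * Real.exp (h e) + (1 - p e) :=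
    fun e => by ring
  simp only [h1, Finset.prod_add]
  rw [← Finset.sum_subset (Finset.subset_univ s.powerset)]
  · refine Finset.sum_congr rfl fun E hE => ?_
    have hE := Finset.mem_powerset.1 hE
    rw [if_pos hE, one_mul, Real.exp_sum, Finset.prod_ite, Finset.filter_mem_eq_inter,
      Finset.inter_eq_right.2 hE, Finset.filter_notMem_eq_sdiff, Finset.prod_mul_distrib]
    ring
  · intro E _ hE
    rw [if_neg (by simpa using hE)]
    ring

/-- A sum over unordered pairs of distinct vertices in terms of all ordered pairs. -/
lemma sum_Edges_eq {n : ℕ} (f : Fin n → Fin n → ℝ) (hf : ∀ u v, f u v = f v u) :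
    ∑ e ∈ Edges n, f e.1 e.2 = (1/2) * (∑ u, ∑ v, f u v - ∑ u, f u u) := by
  have hlt : ∑ e ∈ Edges n, f e.1 e.2 = ∑ u, ∑ v, if u < v then f u v else 0 := by
    rw [Finset.sum_filter, Fintype.sum_prod_type]
  have hgt : ∑ e ∈ Edges n, f e.1 e.2 = ∑ u, ∑ v, if v < u then f u v else 0 := by
    rw [hlt, Finset.sum_comm]
    refine Finset.sum_congr rfl fun u _ => Finset.sum_congr rfl fun v _ => ?_
    rw [hf]
  have hdiag : ∑ u, f u u = ∑ u, ∑ v, if u = v then f u v else 0 := by simp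
  have hall : ∑ u, ∑ v, f u v = ∑ u, ∑ v, (if u < v then f u v else 0)
      + ∑ u, ∑ v, (if v < u then f u v else 0) + ∑ u, ∑ v, (if u = v then f u v else 0) := by
    simp only [← Finset.sum_add_distrib]
    refine Finset.sum_congr rfl fun u _ => Finset.sum_congr rfl fun v _ => ?_
    rcases lt_trichotomy u v with h | h | h
    · simp [h, h.not_gt, h.ne]
    · simp [h]
    · simp [h, h.not_gt, h.ne']
  linarith

lemma sum_mul_L1 {n : ℕ} (hn : n ≠ 0) (x : (Fin n → 𝒳) × Finset (Fin n × Fin n)) (f : 𝒳 → ℝ) :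
    (n : ℝ) * ∑ a, f a * L1 n x a = ∑ v, f (x.1 v) := by
  have hn' : (n : ℝ) ≠ 0 := Nat.cast_ne_zero.2 hn
  rw [Finset.mul_sum, ← Finset.sum_fiberwise (s := Finset.univ) (g := x.1)]
  refine Finset.sum_congr rfl fun a _ => ?_
  rw [Finset.sum_congr rfl (g := fun _ => f a)
    (fun v hv => by rw [(Finset.mem_filter.1 hv).2]), Finset.sum_const, nsmul_eq_mul, L1]
  field_simp

lemma sum_mul_L1_mul_L1 {n : ℕ} (hn : n ≠ 0) (x : (Fin n → 𝒳) × Finset (Fin n × Fin n))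
    (f : 𝒳 → 𝒳 → ℝ) :
    (n : ℝ) ^ 2 * ∑ q : 𝒳 × 𝒳, f q.1 q.2 * L1 n x q.1 * L1 n x q.2
      = ∑ u, ∑ v, f (x.1 u) (x.1 v) := by
  rw [← sum_mul_L1 hn x (fun b => ∑ v, f b (x.1 v))]
  simp only [← sum_mul_L1 hn x (f _)]
  rw [Fintype.sum_prod_type]
  simp only [Finset.mul_sum, Finset.sum_mul]
  refine Finset.sum_congr rfl fun u _ => Finset.sum_congr rfl fun v _ => ?_
  ring

lemma sum_mul_L2 {n : ℕ} (hn : n ≠ 0) {an : ℝ} (han : an ≠ 0)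
    (x : (Fin n → 𝒳) × Finset (Fin n × Fin n)) {g : 𝒳 × 𝒳 → ℝ}
    (hg : ∀ i j, g (i, j) = g (j, i)) :
    (n : ℝ) ^ 2 * an * ((1/2) * ∑ q, g q * L2 an n x q) = ∑ e ∈ x.2, g (x.1 e.1, x.1 e.2) := by
  have hn' : (n : ℝ) ≠ 0 := Nat.cast_ne_zero.2 hn
  have key : ∑ q, g q * ∑ e ∈ x.2, ((if (x.1 e.1, x.1 e.2) = q then (1:ℝ) else 0)
      + (if (x.1 e.2, x.1 e.1) = q then (1:ℝ) else 0))
      = 2 * ∑ e ∈ x.2, g (x.1 e.1, x.1 e.2) := by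
    simp only [Finset.mul_sum]
    rw [Finset.sum_comm]
    refine Finset.sum_congr rfl fun e _ => ?_
    simp only [mul_add, mul_ite, mul_one, mul_zero, Finset.sum_add_distrib, Finset.sum_ite_eq,
      Finset.mem_univ, if_true]
    rw [hg (x.1 e.2)]
    ring
  simp only [L2, mul_div_assoc', ← Finset.sum_div, key]
  field_simp

lemma sum_Edges_tilt_le {p C : 𝒳 → 𝒳 → ℝ} (hCsymm : ∀ a b, C a b = C b a) {an : ℝ}
    (han : 0 < an) {g : 𝒳 × 𝒳 → ℝ} (hg : ∀ i j, g (i, j) = g (j, i)) {n : ℕ} (hn : n ≠ 0)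
    (x : (Fin n → 𝒳) × Finset (Fin n × Fin n)) :
    ∑ e ∈ Edges n, p (x.1 e.1) (x.1 e.2) * (Real.exp (g (x.1 e.1, x.1 e.2)) - 1)
      ≤ (n : ℝ) ^ 2 * an * (tiltError p C an g n - (1/2) * ∑ q : 𝒳 × 𝒳,
        (1 - Real.exp (g q)) * (C q.1 q.2 * L1 n x q.1 * L1 n x q.2)) := by
  have hn' : (0 : ℝ) < n := by positivity
  set δ := ∑ q : 𝒳 × 𝒳, |p q.1 q.2 / an - C q.1 q.2| with hδ
  set B := ∑ q : 𝒳 × 𝒳, |Real.exp (g q) - 1| with hB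
  set D := ∑ q : 𝒳 × 𝒳, |C q.1 q.2 * (Real.exp (g q) - 1)| with hD
  set f : 𝒳 → 𝒳 → ℝ := fun i j => C i j * (Real.exp (g (i, j)) - 1) with hf
  have hδ0 : 0 ≤ δ := Finset.sum_nonneg fun _ _ => abs_nonneg _
  have hB0 : 0 ≤ B := Finset.sum_nonneg fun _ _ => abs_nonneg _
  have hterm : ∀ i j, p i j * (Real.exp (g (i, j)) - 1) ≤ an * f i j + an * (δ * B) := by
    intro i j
    have h1 : |p i j / an - C i j| ≤ δ :=
      Finset.single_le_sum (f := fun q : 𝒳 × 𝒳 => |p q.1 q.2 / an - C q.1 q.2|)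
        (fun _ _ => abs_nonneg _) (Finset.mem_univ (i, j))
    have h2 : |Real.exp (g (i, j)) - 1| ≤ B :=
      Finset.single_le_sum (f := fun q : 𝒳 × 𝒳 => |Real.exp (g q) - 1|)
        (fun _ _ => abs_nonneg _) (Finset.mem_univ (i, j))
    have h3 : (p i j / an - C i j) * (Real.exp (g (i, j)) - 1) ≤ δ * B := by
      refine (le_abs_self _).trans ?_
      rw [abs_mul]
      gcongr
    have h4 : p i j * (Real.exp (g (i, j)) - 1)
        = an * f i j + an * ((p i j / an - C i j) * (Real.exp (g (i, j)) - 1)) := by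
      simp only [hf]
      field_simp
      ring
    rw [h4]
    gcongr
  have hcard : ((Edges n).card : ℝ) ≤ (n : ℝ) ^ 2 := by
    have : (Edges n).card ≤ n * n := by
      simpa using Finset.card_le_univ (Edges n)
    rw [pow_two]
    exact_mod_cast this
  have hdiag : -∑ u, f (x.1 u) (x.1 u) ≤ n * D := by
    rw [← Finset.sum_neg_distrib]
    calc ∑ u, -f (x.1 u) (x.1 u) ≤ ∑ _u : Fin n, D := by
          refine Finset.sum_le_sum fun u _ => (neg_le_abs _).trans ?_
          exact Finset.single_le_sum
            (f := fun q : 𝒳 × 𝒳 => |C q.1 q.2 * (Real.exp (g q) - 1)|)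
            (fun _ _ => abs_nonneg _) (Finset.mem_univ (x.1 u, x.1 u))
      _ = n * D := by simp
  have hD0 : 0 ≤ D := Finset.sum_nonneg fun _ _ => abs_nonneg _
  have hsum : ∑ q : 𝒳 × 𝒳, (1 - Real.exp (g q)) * (C q.1 q.2 * L1 n x q.1 * L1 n x q.2)
      = -∑ q : 𝒳 × 𝒳, f q.1 q.2 * L1 n x q.1 * L1 n x q.2 := by
    rw [← Finset.sum_neg_distrib]
    refine Finset.sum_congr rfl fun q _ => ?_
    simp only [hf]
    ring
  have hedge := sum_Edges_eq (fun u v => f (x.1 u) (x.1 v))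
    (fun u v => by simp only [hf]; rw [hCsymm, hg])
  rw [← sum_mul_L1_mul_L1 hn x f] at hedge
  calc _ ≤ ∑ e ∈ Edges n, (an * f (x.1 e.1) (x.1 e.2) + an * (δ * B)) :=
        Finset.sum_le_sum fun e _ => hterm _ _
    _ = an * ∑ e ∈ Edges n, f (x.1 e.1) (x.1 e.2) + (Edges n).card * (an * (δ * B)) := by
        rw [Finset.sum_add_distrib, ← Finset.mul_sum, Finset.sum_const, nsmul_eq_mul]
    _ ≤ an * ((1/2) * ((n : ℝ) ^ 2 * ∑ q : 𝒳 × 𝒳, f q.1 q.2 * L1 n x q.1 * L1 n x q.2)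
          + n * D) + (n : ℝ) ^ 2 * (an * (δ * B)) := by
        gcongr
        rw [hedge]
        nlinarith [mul_nonneg hn'.le hD0]
    _ = _ := by
        rw [hsum, tiltError, ← hδ, ← hB, ← hD]
        clear_value δ B D f
        field_simp
        ring

/-- Exponential moment bound for `tiltFunctional` of the empirical measures. -/
lemma sum_graphWeight_mul_exp_le {μ : 𝒳 → ℝ} (hμ0 : ∀ a, 0 ≤ μ a) (hμs : ∑ a, μ a = 1)
    {p C : 𝒳 → 𝒳 → ℝ} (hp0 : ∀ a b, 0 ≤ p a b) (hp1 : ∀ a b, p a b ≤ 1)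
    (hCsymm : ∀ a b, C a b = C b a) {an : ℝ} (han : 0 < an) {g : 𝒳 × 𝒳 → ℝ}
    (hg : ∀ i j, g (i, j) = g (j, i)) {n : ℕ} (hn : n ≠ 0) :
    ∑ x, graphWeight μ p n x *
        Real.exp ((n : ℝ) ^ 2 * an * tiltFunctional C g (L1 n x, L2 an n x))
      ≤ Real.exp ((n : ℝ) ^ 2 * an * tiltError p C an g n) := by
  rw [Fintype.sum_prod_type]
  have hcol : ∀ X : Fin n → 𝒳,
      ∑ E, graphWeight μ p n (X, E) *
        Real.exp ((n : ℝ) ^ 2 * an * tiltFunctional C g (L1 n (X, E), L2 an n (X, E)))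
      ≤ (∏ v, μ (X v)) * Real.exp ((n : ℝ) ^ 2 * an * tiltError p C an g n) := by
    intro X
    set R : ℝ := (1/2) * ∑ q : 𝒳 × 𝒳,
      (1 - Real.exp (g q)) * (C q.1 q.2 * L1 n (X, ∅) q.1 * L1 n (X, ∅) q.2) with hR
    have hE : ∀ E, graphWeight μ p n (X, E) *
        Real.exp ((n : ℝ) ^ 2 * an * tiltFunctional C g (L1 n (X, E), L2 an n (X, E)))
        = (∏ v, μ (X v)) * Real.exp ((n : ℝ) ^ 2 * an * R) *
          ((if E ⊆ Edges n then (1 : ℝ) else 0) *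
            (∏ e ∈ Edges n, if e ∈ E then p (X e.1) (X e.2) else 1 - p (X e.1) (X e.2)) *
            Real.exp (∑ e ∈ E, g (X e.1, X e.2))) := by
      intro E
      have h1 : tiltFunctional C g (L1 n (X, E), L2 an n (X, E))
          = (1/2) * ∑ q, g q * L2 an n (X, E) q + R := rfl
      rw [h1, mul_add, sum_mul_L2 hn han.ne' (X, E) hg, Real.exp_add, graphWeight]
      ring
    rw [Finset.sum_congr rfl fun E _ => hE E, ← Finset.mul_sum,
      sum_edges_mgf (Edges n) (fun e => p (X e.1) (X e.2)) (fun e => g (X e.1, X e.2)), mul_assoc]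
    refine mul_le_mul_of_nonneg_left ?_ (Finset.prod_nonneg fun _ _ => hμ0 _)
    have hprod : ∏ e ∈ Edges n, (1 + p (X e.1) (X e.2) * (Real.exp (g (X e.1, X e.2)) - 1))
        ≤ Real.exp (∑ e ∈ Edges n, p (X e.1) (X e.2) * (Real.exp (g (X e.1, X e.2)) - 1)) := by
      rw [Real.exp_sum]
      refine Finset.prod_le_prod (fun e _ => ?_) (fun e _ => ?_)
      · nlinarith [mul_nonneg (hp0 (X e.1) (X e.2)) (Real.exp_pos (g (X e.1, X e.2))).le,
          hp1 (X e.1) (X e.2)]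
      · rw [add_comm]
        exact Real.add_one_le_exp _
    refine (mul_le_mul_of_nonneg_left hprod (Real.exp_pos _).le).trans ?_
    rw [← Real.exp_add, Real.exp_le_exp]
    have := sum_Edges_tilt_le (p := p) hCsymm han hg hn (X, ∅)
    simp only [← hR] at this
    linarith
  refine (Finset.sum_le_sum fun X _ => hcol X).trans ?_
  rw [← Finset.sum_mul, ← Fintype.prod_sum (fun (_ : Fin n) a => μ a)]
  simp [hμs]

lemma graphPr_le_sum_exp {μ : 𝒳 → ℝ} (hμ0 : ∀ a, 0 ≤ μ a) (hμs : ∑ a, μ a = 1)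
    {p C : 𝒳 → 𝒳 → ℝ} (hp0 : ∀ a b, 0 ≤ p a b) (hp1 : ∀ a b, p a b ≤ 1)
    (hCsymm : ∀ a b, C a b = C b a) {an : ℝ} (han : 0 < an) {G : Finset (𝒳 × 𝒳 → ℝ)}
    (hG : ∀ g ∈ G, ∀ i j, g (i, j) = g (j, i)) {F : Set ((𝒳 → ℝ) × (𝒳 × 𝒳 → ℝ))} {α : ℝ}
    (hF : ∀ z ∈ F, ∃ g ∈ G, α < tiltFunctional C g z) {n : ℕ} (hn : n ≠ 0) :
    graphPr μ p n {x | (L1 n x, L2 an n x) ∈ F}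
      ≤ ∑ g ∈ G, Real.exp ((n : ℝ) ^ 2 * an * (tiltError p C an g n - α)) := by
  have hpt : ∀ x, Set.indicator {x | (L1 n x, L2 an n x) ∈ F} (graphWeight μ p n) x
      ≤ ∑ g ∈ G, Real.exp (-((n : ℝ) ^ 2 * an * α)) * (graphWeight μ p n x *
        Real.exp ((n : ℝ) ^ 2 * an * tiltFunctional C g (L1 n x, L2 an n x))) := by
    intro x
    have hw := graphWeight_nonneg hμ0 hp0 hp1 n x
    have hnn : ∀ g ∈ G, 0 ≤ Real.exp (-((n : ℝ) ^ 2 * an * α)) * (graphWeight μ p n x *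
        Real.exp ((n : ℝ) ^ 2 * an * tiltFunctional C g (L1 n x, L2 an n x))) :=
      fun g _ => by positivity
    refine Set.indicator_apply_le' (fun hx => ?_) (fun _ => Finset.sum_nonneg hnn)
    obtain ⟨g, hg, hlt⟩ := hF _ hx
    refine le_trans ?_ (Finset.single_le_sum hnn hg)
    rw [mul_left_comm, ← Real.exp_add]
    refine le_mul_of_one_le_right hw (Real.one_le_exp ?_)
    have : (n : ℝ) ^ 2 * an * α
        ≤ (n : ℝ) ^ 2 * an * tiltFunctional C g (L1 n x, L2 an n x) := by gcongr
    linarith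
  refine (Finset.sum_le_sum fun x _ => hpt x).trans ?_
  rw [Finset.sum_comm]
  refine Finset.sum_le_sum fun g hg => ?_
  rw [← Finset.mul_sum]
  refine (mul_le_mul_of_nonneg_left
    (sum_graphWeight_mul_exp_le hμ0 hμs hp0 hp1 hCsymm han (hG g hg) hn)
    (Real.exp_pos _).le).trans (le_of_eq ?_)
  rw [← Real.exp_add]
  ring_nf

end Moments

lemma coe_mul_elog_le {c P N β : ℝ} (hc : 0 < c) (hP : P ≤ N * Real.exp (c * β)) (hN : 0 < N) :
    ((1 / c : ℝ) : EReal) * elog P ≤ ((Real.log N / c + β : ℝ) : EReal) := by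
  have hc' : 0 < 1 / c := by positivity
  unfold elog
  split_ifs with h
  · rw [EReal.coe_mul_bot_of_pos hc']
    exact bot_le
  · push Not at h
    rw [← EReal.coe_mul, EReal.coe_le_coe_iff]
    have h2 : Real.log P ≤ Real.log N + c * β := by
      rw [← Real.log_exp (c * β), ← Real.log_mul hN.ne' (Real.exp_pos _).ne']
      exact Real.log_le_log h hP
    calc 1 / c * Real.log P ≤ 1 / c * (Real.log N + c * β) := by gcongr
      _ = _ := by field_simp

end CRG

/-- **Upper bound in Theorem 2.4(i)** (Lemma 3.8): for the supercritical coloured random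
graph, for every closed `F ⊆ ℳ(𝒳) × ℳ̃_*(𝒳×𝒳)`,
`limsup (1/(aₙ n²)) log ℙ{(L¹,L²) ∈ F} ≤ −inf_F Î₁`. -/
theorem upper_bound_speed_an_nsq_supercritical
    {𝒳 : Type} [Fintype 𝒳] [DecidableEq 𝒳] [Nonempty 𝒳]
    (μ : 𝒳 → ℝ) (hμ0 : ∀ a, 0 < μ a) (hμ1 : ∀ a, μ a ≤ 1) (hμs : ∑ a, μ a = 1)
    (p : ℕ → 𝒳 → 𝒳 → ℝ) (hp0 : ∀ n a b, 0 ≤ p n a b) (hp1 : ∀ n a b, p n a b ≤ 1)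
    (hpsymm : ∀ n a b, p n a b = p n b a)
    (C : 𝒳 → 𝒳 → ℝ) (hC0 : ∀ a b, 0 ≤ C a b) (hCsymm : ∀ a b, C a b = C b a)
    (a : ℕ → ℝ) (hapos : ∀ n, 0 < a n)
    (hconv : ∀ i j, Filter.Tendsto (fun n => p n i j / a n) Filter.atTop (nhds (C i j)))
    (ha0 : Filter.Tendsto a Filter.atTop (nhds 0))
    (hna : Filter.Tendsto (fun n : ℕ => (n : ℝ) * a n) Filter.atTop Filter.atTop)
    :
    ∀ F : Set ((𝒳 → ℝ) × (𝒳 × 𝒳 → ℝ)), F ⊆ MSpace 𝒳 → IsClosed F →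
      Filter.limsup (fun n : ℕ => ((1 / (a n * (n:ℝ)^2) : ℝ) : EReal) *
          elog (graphPr μ (p n) n {x | (L1 n x, L2 (a n) n x) ∈ F})) Filter.atTop
        ≤ - ⨅ z ∈ F, Ihat1 C z.1 z.2 := by
  intro F hF hFc
  rw [EReal.le_neg]
  refine EReal.ge_of_forall_gt_iff_ge.1 fun α hα => ?_
  rw [EReal.le_neg]
  obtain ⟨G, hG, hcov⟩ := exists_finset_tilt_cover hC0 hF hFc
    (fun z hz => hα.trans_le (iInf₂_le z hz))
  have hspeed : Tendsto (fun n : ℕ => a n * (n : ℝ) ^ 2) atTop atTop := by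
    refine (hna.atTop_mul_atTop₀ tendsto_natCast_atTop_atTop).congr fun n => ?_
    ring
  set N : ℝ := G.card + 1 with hN
  have hN0 : 0 < N := by positivity
  set ε : ℕ → ℝ := fun n => ∑ g ∈ G, |tiltError (p n) C (a n) g n| with hε
  have hε0 : Tendsto ε atTop (nhds 0) := by
    rw [show (0 : ℝ) = ∑ g ∈ G, |(0 : ℝ)| by simp]
    exact tendsto_finsetSum _ fun g _ => (tendsto_tiltError hconv g).abs
  have hlim : Tendsto (fun n : ℕ => Real.log N / (a n * (n : ℝ) ^ 2) + (ε n - α)) atTop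
      (nhds (-α)) := by
    simpa using (hspeed.const_div_atTop (Real.log N)).add (hε0.sub_const α)
  have hlimE := (continuous_coe_real_ereal.tendsto (-α)).comp hlim
  rw [← EReal.coe_neg, ← hlimE.limsup_eq]
  refine limsup_le_limsup ?_
  filter_upwards [eventually_ne_atTop 0] with n hn
  have hc : 0 < a n * (n : ℝ) ^ 2 := by
    have := hapos n
    positivity
  refine coe_mul_elog_le hc ?_ hN0
  refine (graphPr_le_sum_exp (fun i => (hμ0 i).le) hμs (hp0 n) (hp1 n) hCsymm (hapos n) hG hcov
    hn).trans ?_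
  have hterm : ∀ g ∈ G, Real.exp ((n : ℝ) ^ 2 * a n * (tiltError (p n) C (a n) g n - α))
      ≤ Real.exp (a n * (n : ℝ) ^ 2 * (ε n - α)) := by
    intro g hg
    rw [Real.exp_le_exp, mul_comm ((n : ℝ) ^ 2)]
    gcongr
    exact (le_abs_self _).trans (Finset.single_le_sum
      (f := fun g => |tiltError (p n) C (a n) g n|) (fun _ _ => abs_nonneg _) hg)
  refine (Finset.sum_le_card_nsmul _ _ _ hterm).trans ?_
  rw [nsmul_eq_mul]
  gcongr
  linarith
end
end

section
/- Let 𝒳 be a finite set and C : 𝒳×𝒳 → [0,∞) symmetric. For every probability measure ω on 𝒳 and every finite symmetric measure ϖ on 𝒳×𝒳, sup over symmetric functions g : 𝒳×𝒳 → ℝ of [ (1/2)·Σ_{a,b∈𝒳} g(a,b)·ϖ(a,b) + (1/2)·Σ_{a,b∈𝒳} (1 − e^{g(a,b)})·C(a,b)·ω(a)·ω(b) ] equals (1/2)·𝔥_C(ϖ‖ω); in particular the supremum is +∞ whenever ϖ is not absolutely continuous with respect to Cω⊗ω. -/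
open Filter
open scoped ENNReal

noncomputable section

open CRG

/-- Young's inequality for the Poisson entropy: `p log (p / r) + r - p` dominates
`g p + (1 - e^g) r`. -/
lemma mul_add_one_sub_exp_mul_le {p r : ℝ} (hp : 0 ≤ p) (hr : 0 ≤ r) (hac : r = 0 → p = 0)
    (g : ℝ) : g * p + (1 - Real.exp g) * r ≤ p * Real.log (p / r) + r - p := by
  rcases hp.eq_or_lt with rfl | hp
  · have := mul_nonneg (Real.exp_pos g).le hr
    simp only [mul_zero, zero_mul]
    linarith
  · have hr : 0 < r := hr.lt_of_ne fun h => hp.ne' (hac h.symm)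
    have h₁ := mul_le_mul_of_nonneg_left (Real.add_one_le_exp (g - Real.log (p / r))) hp.le
    have h₂ : p * Real.exp (g - Real.log (p / r)) = Real.exp g * r := by
      rw [Real.exp_sub, Real.exp_log (div_pos hp hr)]
      field_simp
    linarith

/-- The choice `g = log (p / r)`, truncated to `-M` where `p = 0`, attains the bound of
`mul_add_one_sub_exp_mul_le` up to `e^(-M) r`. -/
lemma le_truncated_log_mul_add {p r : ℝ} (hp : 0 ≤ p) (hr : 0 ≤ r) (hac : r = 0 → p = 0)
    (M : ℝ) : p * Real.log (p / r) + r - p - Real.exp (-M) * r ≤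
      (if p = 0 then -M else Real.log (p / r)) * p
        + (1 - Real.exp (if p = 0 then -M else Real.log (p / r))) * r := by
  split_ifs with h
  · subst h
    simp only [mul_zero, zero_mul]
    linarith
  · have hp : 0 < p := hp.lt_of_ne' h
    have hr : 0 < r := hr.lt_of_ne fun h' => h (hac h'.symm)
    have h₁ := mul_pos (Real.exp_pos (-M)) hr
    have h₂ : p / r * r = p := div_mul_cancel₀ p hr.ne'
    rw [Real.exp_log (div_pos hp hr)]
    linarith

lemma le_Ihat1 {𝒳 : Type} [Fintype 𝒳] (C : 𝒳 → 𝒳 → ℝ) (ω : 𝒳 → ℝ) (ϖ : 𝒳 × 𝒳 → ℝ)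
    {g : 𝒳 × 𝒳 → ℝ} (hg : ∀ i j, g (i,j) = g (j,i)) {x : ℝ}
    (hx : x ≤ (1/2) * ∑ q : 𝒳 × 𝒳, (g q * ϖ q
      + (1 - Real.exp (g q)) * (C q.1 q.2 * ω q.1 * ω q.2))) :
    (x : EReal) ≤ Ihat1 C ω ϖ := by
  refine le_iSup₂_of_le g hg (EReal.coe_le_coe_iff.2 ?_)
  rwa [← mul_add, ← Finset.sum_add_distrib]

lemma Ihat1_eq_top {𝒳 : Type} [Fintype 𝒳]
    (C : 𝒳 → 𝒳 → ℝ) (hCsymm : ∀ a b, C a b = C b a) (ω : 𝒳 → ℝ)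
    (ϖ : 𝒳 × 𝒳 → ℝ) (hϖ0 : ∀ q, 0 ≤ ϖ q)
    (h : ¬ ∀ q : 𝒳 × 𝒳, C q.1 q.2 * ω q.1 * ω q.2 = 0 → ϖ q = 0) :
    Ihat1 C ω ϖ = ⊤ := by
  push Not at h
  obtain ⟨q₀, hr, hq⟩ := h
  have hq : 0 < ϖ q₀ := (hϖ0 q₀).lt_of_ne' hq
  refine EReal.eq_top_iff_forall_lt _ |>.2 fun y => (EReal.coe_lt_coe_iff.2 (lt_add_one y)).trans_le ?_
  set M : ℝ := 2 * (|y| + 1) / ϖ q₀ with hM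
  have hM0 : 0 ≤ M := by positivity
  refine le_Ihat1 C ω ϖ (g := fun q => if C q.1 q.2 * ω q.1 * ω q.2 = 0 then M else 0) ?_ ?_
  · intro i j
    simp only [hCsymm i j, mul_right_comm _ (ω i) (ω j)]
  · have hle := Finset.single_le_sum (s := Finset.univ) (f := fun q : 𝒳 × 𝒳 =>
        (if C q.1 q.2 * ω q.1 * ω q.2 = 0 then M else 0) * ϖ q
          + (1 - Real.exp (if C q.1 q.2 * ω q.1 * ω q.2 = 0 then M else 0))
            * (C q.1 q.2 * ω q.1 * ω q.2)) (fun q _ => by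
        split_ifs with h
        · rw [h, mul_zero, add_zero]
          exact mul_nonneg hM0 (hϖ0 q)
        · simp) (Finset.mem_univ q₀)
    simp only [hr, if_true, mul_zero, add_zero] at hle
    have hMq : M * ϖ q₀ = 2 * (|y| + 1) := div_mul_cancel₀ _ hq.ne'
    linarith [le_abs_self y]

lemma Ihat1_eq_of_absolutelyContinuous {𝒳 : Type} [Fintype 𝒳]
    (C : 𝒳 → 𝒳 → ℝ) (hC0 : ∀ a b, 0 ≤ C a b) (hCsymm : ∀ a b, C a b = C b a)
    (ω : 𝒳 → ℝ) (hω0 : ∀ a, 0 ≤ ω a)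
    (ϖ : 𝒳 × 𝒳 → ℝ) (hϖ0 : ∀ q, 0 ≤ ϖ q) (hϖsymm : ∀ i j, ϖ (i,j) = ϖ (j,i))
    (h : ∀ q : 𝒳 × 𝒳, C q.1 q.2 * ω q.1 * ω q.2 = 0 → ϖ q = 0) :
    Ihat1 C ω ϖ = (((1/2) * ∑ q : 𝒳 × 𝒳, (ϖ q * Real.log (ϖ q / (C q.1 q.2 * ω q.1 * ω q.2))
      + C q.1 q.2 * ω q.1 * ω q.2 - ϖ q) : ℝ) : EReal) := by
  have hr0 (q : 𝒳 × 𝒳) : 0 ≤ C q.1 q.2 * ω q.1 * ω q.2 :=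
    mul_nonneg (mul_nonneg (hC0 _ _) (hω0 _)) (hω0 _)
  apply le_antisymm
  · refine iSup₂_le fun g _ => EReal.coe_le_coe_iff.2 ?_
    rw [← mul_add, ← Finset.sum_add_distrib]
    gcongr with q
    exact mul_add_one_sub_exp_mul_le (hϖ0 q) (hr0 q) (h q) (g q)
  · have hlim : Tendsto (fun M : ℝ => (1/2) * ∑ q : 𝒳 × 𝒳,
        (ϖ q * Real.log (ϖ q / (C q.1 q.2 * ω q.1 * ω q.2)) + C q.1 q.2 * ω q.1 * ω q.2 - ϖ q
          - Real.exp (-M) * (C q.1 q.2 * ω q.1 * ω q.2))) atTop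
        (nhds ((1/2) * ∑ q : 𝒳 × 𝒳, (ϖ q * Real.log (ϖ q / (C q.1 q.2 * ω q.1 * ω q.2))
          + C q.1 q.2 * ω q.1 * ω q.2 - ϖ q))) := by
      refine (tendsto_finsetSum _ fun q _ => ?_).const_mul _
      simpa using (Real.tendsto_exp_neg_atTop_nhds_zero.mul_const
        (C q.1 q.2 * ω q.1 * ω q.2)).const_sub
        (ϖ q * Real.log (ϖ q / (C q.1 q.2 * ω q.1 * ω q.2)) + C q.1 q.2 * ω q.1 * ω q.2 - ϖ q)
    refine le_of_tendsto' ((continuous_coe_real_ereal.tendsto _).comp hlim) fun M => ?_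
    refine le_Ihat1 C ω ϖ (g := fun q => if ϖ q = 0 then -M else
      Real.log (ϖ q / (C q.1 q.2 * ω q.1 * ω q.2))) ?_ ?_
    · intro i j
      simp only [hϖsymm i j, hCsymm i j, mul_right_comm _ (ω i) (ω j)]
    · refine mul_le_mul_of_nonneg_left (Finset.sum_le_sum fun q _ => ?_) (by norm_num)
      exact le_truncated_log_mul_add (hϖ0 q) (hr0 q) (h q) M

/-- **Solution of the variational problem for `Î₁`** (Lemma 3.9):
`Î₁(ω,ϖ) = ½ 𝔥_C(ϖ‖ω)`; in particular the supremum is `+∞` whenever `ϖ` is not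
absolutely continuous with respect to `Cω⊗ω`. -/
theorem variational_Ihat1
    {𝒳 : Type} [Fintype 𝒳] [DecidableEq 𝒳] [Nonempty 𝒳]
    (C : 𝒳 → 𝒳 → ℝ) (hC0 : ∀ a b, 0 ≤ C a b) (hCsymm : ∀ a b, C a b = C b a)
    (ω : 𝒳 → ℝ) (hω0 : ∀ a, 0 ≤ ω a) (hωs : ∑ a, ω a = 1)
    (ϖ : 𝒳 × 𝒳 → ℝ) (hϖ0 : ∀ q, 0 ≤ ϖ q) (hϖsymm : ∀ i j, ϖ (i,j) = ϖ (j,i)) :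
    Ihat1 C ω ϖ = (((1:ℝ)/2 : ℝ) : EReal) * ((hRel C ω ϖ : ℝ≥0∞) : EReal)
    ∧ (¬ (∀ q : 𝒳 × 𝒳, C q.1 q.2 * ω q.1 * ω q.2 = 0 → ϖ q = 0) → Ihat1 C ω ϖ = ⊤) := by
  refine ⟨?_, Ihat1_eq_top C hCsymm ω ϖ hϖ0⟩
  by_cases h : ∀ q : 𝒳 × 𝒳, C q.1 q.2 * ω q.1 * ω q.2 = 0 → ϖ q = 0
  · have hnonneg : 0 ≤ ∑ q : 𝒳 × 𝒳, (ϖ q * Real.log (ϖ q / (C q.1 q.2 * ω q.1 * ω q.2))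
        + C q.1 q.2 * ω q.1 * ω q.2 - ϖ q) := Finset.sum_nonneg fun q _ => by
      simpa using mul_add_one_sub_exp_mul_le (hϖ0 q)
        (mul_nonneg (mul_nonneg (hC0 q.1 q.2) (hω0 q.1)) (hω0 q.2)) (h q) 0
    rw [Ihat1_eq_of_absolutelyContinuous C hC0 hCsymm ω hω0 ϖ hϖ0 hϖsymm h, hRel, if_pos h,
      ← Finset.sum_add_distrib, ← Finset.sum_sub_distrib, EReal.coe_ennreal_ofReal,
      max_eq_left hnonneg, EReal.coe_mul]
  · rw [Ihat1_eq_top C hCsymm ω ϖ hϖ0 h, hRel, if_neg h, EReal.coe_ennreal_top,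
      EReal.coe_mul_top_of_pos (by norm_num)]
end
end
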